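/- arXiv:2503.00273 — 3 statements merged into one kernel-verified Lean document; each statement's English description precedes it below -/
import Mathlib

section
/- For every ε ∈ (0,1) there exists a constant c > 0 such that for all integers n ≥ 2, all Δ ∈ (0, 1-ε], and all horizons t ∈ ℕ with 1/Δ² < t ≤ (log n)/Δ², the optimal mutual information satisfies I*_t ≥ c·t²·Δ⁴/n. -/
open scoped BigOperators

noncomputable section

/-- Probability that pulling arm `a` yields reward `r : Bool` (with `true` = reward 1),
when the best arm is `astar`: `Bernoulli ((1+Δ)/2)` if `a = astar`, else `Bernoulli ((1-Δ)/2)`. -/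
def rewP (n : ℕ) (Δ : ℝ) (astar a : Fin n) (r : Bool) : ℝ :=
  if r then (if a = astar then (1 + Δ) / 2 else (1 - Δ) / 2)
  else 1 - (if a = astar then (1 + Δ) / 2 else (1 - Δ) / 2)

/-- An interactive algorithm: for every history (recorded with the most recent pull first),
a probability distribution over the `n` arms used to draw the next pull. -/
def IsAlg (n : ℕ) (alg : List (Fin n × Bool) → Fin n → ℝ) : Prop :=
  ∀ h : List (Fin n × Bool), (∀ a, 0 ≤ alg h a) ∧ (∑ a : Fin n, alg h a) = 1

/-- Probability, conditionally on the best arm `astar`, of observing a given history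
(recorded with the most recent pull first) when running the algorithm `alg`. -/
def histP (n : ℕ) (alg : List (Fin n × Bool) → Fin n → ℝ) (Δ : ℝ) (astar : Fin n) :
    List (Fin n × Bool) → ℝ
  | [] => 1
  | (a, r) :: prev => histP n alg Δ astar prev * alg prev a * rewP n Δ astar a r

/-- The reversed history (most recent pull first) associated with a tuple of `t` pulls. -/
def hist {n t : ℕ} (h : Fin t → Fin n × Bool) : List (Fin n × Bool) :=
  (List.ofFn h).reverse

/-- Success probability `P(a_{t+1} = a*)` of an interactive algorithm after `t` rounds,
under the uniform prior on the best arm. -/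
def succProb (n t : ℕ) (alg : List (Fin n × Bool) → Fin n → ℝ) (Δ : ℝ) : ℝ :=
  ((n : ℝ))⁻¹ * ∑ astar : Fin n, ∑ h : Fin t → Fin n × Bool,
    histP n alg Δ astar (hist h) * alg (hist h) astar

/-- Mutual information (in nats) `I(a*; H_t)` accumulated by an interactive algorithm. -/
def mutualInfo (n t : ℕ) (alg : List (Fin n × Bool) → Fin n → ℝ) (Δ : ℝ) : ℝ :=
  ∑ astar : Fin n, ∑ h : Fin t → Fin n × Bool,
    ((n : ℝ))⁻¹ * histP n alg Δ astar (hist h) *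
      Real.log (histP n alg Δ astar (hist h) /
        (((n : ℝ))⁻¹ * ∑ b : Fin n, histP n alg Δ b (hist h)))

/-- Optimal success probability `p*_t`. -/
def pStar (n t : ℕ) (Δ : ℝ) : ℝ :=
  sSup {x : ℝ | ∃ alg, IsAlg n alg ∧ x = succProb n t alg Δ}

/-- Optimal mutual information `I*_t`. -/
def IStar (n t : ℕ) (Δ : ℝ) : ℝ :=
  sSup {x : ℝ | ∃ alg, IsAlg n alg ∧ x = mutualInfo n t alg Δ}

theorem strongConvex_mul_log {x y p : ℝ} (hx : x ∈ Set.Ioo (0:ℝ) 1) (hy : y ∈ Set.Ioo (0:ℝ) 1)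
    (hp : 0 ≤ p) (hp1 : p ≤ 1) :
    ((1 - p) * x + p * y) * Real.log ((1 - p) * x + p * y) ≤
      (1 - p) * (x * Real.log x) + p * (y * Real.log y) - p * (1 - p) * (x - y) ^ 2 / 2 := by
  have hd : ∀ z ∈ Set.Ioo (0:ℝ) 1,
      HasDerivAt (fun z : ℝ => z * Real.log z - z ^ 2 / 2) (Real.log z + 1 - z) z := by
    intro z hz
    have h := (Real.hasDerivAt_mul_log hz.1.ne').sub (((hasDerivAt_id z).pow 2).div_const 2)
    refine h.congr_deriv ?_
    simp
  have hconv : ConvexOn ℝ (Set.Ioo (0:ℝ) 1) (fun z : ℝ => z * Real.log z - z ^ 2 / 2) := by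
    apply MonotoneOn.convexOn_of_deriv (convex_Ioo 0 1)
    · exact fun z hz => (hd z hz).continuousAt.continuousWithinAt
    · rw [interior_Ioo]
      exact fun z hz => (hd z hz).differentiableAt.differentiableWithinAt
    · rw [interior_Ioo]
      intro a ha b hb hab
      rw [(hd a ha).deriv, (hd b hb).deriv]
      have h1 := Real.log_le_sub_one_of_pos (div_pos ha.1 hb.1)
      rw [Real.log_div ha.1.ne' hb.1.ne'] at h1
      have h2 : a / b ≤ 1 + a - b := by
        rw [div_le_iff₀ hb.1]
        nlinarith [hb.2, ha.1]
      linarith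
  have h := hconv.2 hx hy (sub_nonneg.2 hp1) hp (by ring)
  simp only [smul_eq_mul] at h
  nlinarith

/-- Information gained in one pull: `l` is the likelihood ratio of the pulled arm and `T` the total
likelihood ratio of the other arms. -/
theorem entropy_step {Δ l T : ℝ} (hΔ : 0 < Δ) (hΔ1 : Δ < 1) (hl : 0 < l) (hT : 0 ≤ T) :
    l * Real.log l - (T + l) * Real.log (T + l) + Δ ^ 2 * (l * T / (T + l)) ≤
      (1 - Δ) / 2 * (l * ((1 + Δ) / (1 - Δ)) * Real.log (l * ((1 + Δ) / (1 - Δ))) -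
        (T + l * ((1 + Δ) / (1 - Δ))) * Real.log (T + l * ((1 + Δ) / (1 - Δ)))) +
      (1 + Δ) / 2 * (l * ((1 - Δ) / (1 + Δ)) * Real.log (l * ((1 - Δ) / (1 + Δ))) -
        (T + l * ((1 - Δ) / (1 + Δ))) * Real.log (T + l * ((1 - Δ) / (1 + Δ)))) := by
  obtain ⟨u, hu⟩ : ∃ u, u = (1 + Δ) / 2 := ⟨_, rfl⟩
  obtain ⟨v, hv⟩ : ∃ v, v = (1 - Δ) / 2 := ⟨_, rfl⟩
  have hu0 : 0 < u := by linarith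
  have hv0 : 0 < v := by linarith
  have hR : (1 + Δ) / (1 - Δ) = u / v := by rw [hu, hv]; field_simp
  have hR' : (1 - Δ) / (1 + Δ) = v / u := by rw [hu, hv]; field_simp
  have hS : 0 < T + l := by linarith
  obtain ⟨S, hSd⟩ : ∃ S, S = T + l := ⟨_, rfl⟩
  obtain ⟨p, hpd⟩ : ∃ p, p = l / S := ⟨_, rfl⟩
  rw [← hSd] at hS
  have hlp : l = S * p := by rw [hpd]; field_simp
  have hTp : T = S * (1 - p) := by linarith
  have hp0 : 0 < p := hpd ▸ div_pos hl hS
  have hp1 : p ≤ 1 := by nlinarith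
  have huI : u ∈ Set.Ioo (0:ℝ) 1 := ⟨hu0, by linarith⟩
  have hvI : v ∈ Set.Ioo (0:ℝ) 1 := ⟨hv0, by linarith⟩
  have h1 := strongConvex_mul_log hvI huI hp0.le hp1
  have h2 := strongConvex_mul_log huI hvI hp0.le hp1
  have hm1 : 0 < (1 - p) * v + p * u := by nlinarith
  have hm2 : 0 < (1 - p) * u + p * v := by nlinarith
  have e1 : T + l * (u / v) = S * ((1 - p) * v + p * u) / v := by
    rw [hTp, hlp]; field_simp
  have e2 : T + l * (v / u) = S * ((1 - p) * u + p * v) / u := by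
    rw [hTp, hlp]; field_simp
  rw [hR, hR', e1, e2, ← hu, ← hv, ← hSd, Real.log_mul hl.ne' (by positivity),
    Real.log_mul hl.ne' (by positivity), Real.log_div hu0.ne' hv0.ne',
    Real.log_div hv0.ne' hu0.ne', Real.log_div (by positivity) hv0.ne',
    Real.log_div (by positivity) hu0.ne', Real.log_mul hS.ne' hm1.ne',
    Real.log_mul hS.ne' hm2.ne']
  set μ := (1 - p) * v + p * u with hμ
  set ν := (1 - p) * u + p * v with hν
  have hΔe : (v - u) ^ 2 = Δ ^ 2 := by rw [hu, hv]; ring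
  have hΔe' : (u - v) ^ 2 = Δ ^ 2 := by rw [hu, hv]; ring
  rw [hΔe] at h1
  rw [hΔe'] at h2
  have hlT : l * T / S = S * (p * (1 - p)) := by rw [hTp, hlp]; field_simp
  rw [hlT]
  have h3 := mul_le_mul_of_nonneg_left (add_le_add h1 h2) hS.le
  have hvu : v = 1 - u := by linarith
  have key : v * (l * (u / v) * (Real.log l + (Real.log u - Real.log v)) -
        S * μ / v * (Real.log S + Real.log μ - Real.log v)) +
      u * (l * (v / u) * (Real.log l + (Real.log v - Real.log u)) -
        S * ν / u * (Real.log S + Real.log ν - Real.log u)) =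
      l * u * (Real.log l + (Real.log u - Real.log v)) -
        S * μ * (Real.log S + Real.log μ - Real.log v) +
      (l * v * (Real.log l + (Real.log v - Real.log u)) -
        S * ν * (Real.log S + Real.log ν - Real.log u)) := by
    field_simp
  rw [key]
  have hgap : l * u * (Real.log l + (Real.log u - Real.log v)) -
        S * μ * (Real.log S + Real.log μ - Real.log v) +
      (l * v * (Real.log l + (Real.log v - Real.log u)) -
        S * ν * (Real.log S + Real.log ν - Real.log u)) -
      (l * Real.log l - S * Real.log S) = 
      S * ((1 - p) * (v * Real.log v) + p * (u * Real.log u) + 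
        ((1 - p) * (u * Real.log u) + p * (v * Real.log v))) - S * (μ * Real.log μ + ν * Real.log ν) := by
    rw [hlp]
    generalize Real.log μ = a
    generalize Real.log ν = b
    rw [hμ, hν, hvu]
    ring
  nlinarith

/-! ### Deterministic policies and expectations under the null model -/

/-- The policy that always pulls the arm selected by `A`. -/
def detAlg {n : ℕ} (A : List (Fin n × Bool) → Fin n) (h : List (Fin n × Bool)) (a : Fin n) : ℝ :=
  if a = A h then 1 else 0

/-- Reward distribution of a suboptimal arm. -/
def nullRew (Δ : ℝ) (r : Bool) : ℝ := if r then (1 - Δ) / 2 else (1 + Δ) / 2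

/-- Likelihood ratio of one reward between the optimal arm and a suboptimal arm. -/
def rewRatio (Δ : ℝ) (r : Bool) : ℝ := if r then (1 + Δ) / (1 - Δ) else (1 - Δ) / (1 + Δ)

/-- Likelihood ratio of a history between `a` being the optimal arm and all arms being
suboptimal. -/
def likeRatio {n : ℕ} (Δ : ℝ) (a : Fin n) : List (Fin n × Bool) → ℝ
  | [] => 1
  | (a', r) :: h => (if a' = a then rewRatio Δ r else 1) * likeRatio Δ a h

/-- Probability of a history under the policy `A` when all arms are suboptimal. -/
def nullHist {n : ℕ} (Δ : ℝ) (A : List (Fin n × Bool) → Fin n) : List (Fin n × Bool) → ℝ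
  | [] => 1
  | (a, r) :: h => nullHist Δ A h * detAlg A h a * nullRew Δ r

/-- Expectation of a function of the first `t` pulls of the policy `A` when all arms are
suboptimal. -/
def nullExp {n : ℕ} (Δ : ℝ) (A : List (Fin n × Bool) → Fin n) :
    ℕ → (List (Fin n × Bool) → ℝ) → ℝ
  | 0, F => F []
  | t + 1, F => nullExp Δ A t fun h => ∑ r : Bool, nullRew Δ r * F ((A h, r) :: h)

/-- The pulled arms of the history are those selected by `A`. -/
def Compat {n : ℕ} (A : List (Fin n × Bool) → Fin n) : List (Fin n × Bool) → Prop
  | [] => True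
  | (a, _) :: h => a = A h ∧ Compat A h

theorem isAlg_detAlg {n : ℕ} (A : List (Fin n × Bool) → Fin n) : IsAlg n (detAlg A) := by
  intro h
  refine ⟨fun a => ?_, ?_⟩
  · unfold detAlg; split_ifs <;> norm_num
  · simp [detAlg]

theorem nullRew_pos {Δ : ℝ} (h0 : 0 < Δ) (h1 : Δ < 1) (r : Bool) : 0 < nullRew Δ r := by
  unfold nullRew; split_ifs <;> linarith

theorem rewRatio_pos {Δ : ℝ} (h0 : 0 < Δ) (h1 : Δ < 1) (r : Bool) : 0 < rewRatio Δ r := by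
  unfold rewRatio; split_ifs <;> apply div_pos <;> linarith

theorem likeRatio_pos {n : ℕ} {Δ : ℝ} (h0 : 0 < Δ) (h1 : Δ < 1) (a : Fin n)
    (h : List (Fin n × Bool)) : 0 < likeRatio Δ a h := by
  induction h with
  | nil => exact one_pos
  | cons x h ih =>
    obtain ⟨a', r⟩ := x
    refine mul_pos ?_ ih
    split_ifs
    exacts [rewRatio_pos h0 h1 r, one_pos]

theorem nullHist_nonneg {n : ℕ} {Δ : ℝ} (h0 : 0 < Δ) (h1 : Δ < 1)
    (A : List (Fin n × Bool) → Fin n) (h : List (Fin n × Bool)) : 0 ≤ nullHist Δ A h := by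
  induction h with
  | nil => exact zero_le_one
  | cons x h ih =>
    obtain ⟨a, r⟩ := x
    exact mul_nonneg (mul_nonneg ih ((isAlg_detAlg A h).1 a)) (nullRew_pos h0 h1 r).le

theorem rewP_eq {n : ℕ} {Δ : ℝ} (h0 : 0 < Δ) (h1 : Δ < 1) (b a : Fin n) (r : Bool) :
    rewP n Δ b a r = nullRew Δ r * (if a = b then rewRatio Δ r else 1) := by
  have : 1 - Δ ≠ 0 := by linarith
  have : 1 + Δ ≠ 0 := by linarith
  cases r <;> by_cases hab : a = b <;> simp [rewP, nullRew, rewRatio, hab] <;> field_simp <;> ring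

theorem histP_detAlg {n : ℕ} {Δ : ℝ} (h0 : 0 < Δ) (h1 : Δ < 1)
    (A : List (Fin n × Bool) → Fin n) (b : Fin n) (h : List (Fin n × Bool)) :
    histP n (detAlg A) Δ b h = nullHist Δ A h * likeRatio Δ b h := by
  induction h with
  | nil => simp [histP, nullHist, likeRatio]
  | cons x h ih =>
    obtain ⟨a, r⟩ := x
    simp only [histP, nullHist, likeRatio, ih, rewP_eq h0 h1]
    ring

theorem hist_snoc {n t : ℕ} (h : Fin t → Fin n × Bool) (x : Fin n × Bool) :
    hist (Fin.snoc h x : Fin (t + 1) → Fin n × Bool) = x :: hist h := by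
  rw [hist, List.ofFn_succ']
  simp [hist]

theorem sum_nullHist {n : ℕ} {Δ : ℝ} (A : List (Fin n × Bool) → Fin n) (t : ℕ)
    (F : List (Fin n × Bool) → ℝ) :
    ∑ h : Fin t → Fin n × Bool, nullHist Δ A (hist h) * F (hist h) = nullExp Δ A t F := by
  induction t generalizing F with
  | zero => simp [hist, nullHist, nullExp]
  | succ t ih =>
    rw [nullExp, ← ih, ← (Fin.snocEquiv fun _ => Fin n × Bool).sum_comp,
      Fintype.sum_prod_type_right]
    refine Finset.sum_congr rfl fun h _ => ?_
    simp only [Fin.snocEquiv, Equiv.coe_fn_mk]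
    rw [Fintype.sum_prod_type, Finset.sum_eq_single (A (hist h))]
    · rw [Finset.mul_sum]
      refine Finset.sum_congr rfl fun r _ => ?_
      erw [hist_snoc]
      simp only [nullHist, detAlg, if_true]
      ring
    · intro a _ ha
      refine Finset.sum_eq_zero fun r _ => ?_
      erw [hist_snoc]
      simp [nullHist, detAlg, ha]
    · simp

theorem nullExp_mono {n : ℕ} {Δ : ℝ} (h0 : 0 < Δ) (h1 : Δ < 1) {A : List (Fin n × Bool) → Fin n}
    {t : ℕ} {F G : List (Fin n × Bool) → ℝ}
    (hFG : ∀ h, h.length = t → Compat A h → F h ≤ G h) : nullExp Δ A t F ≤ nullExp Δ A t G := by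
  induction t generalizing F G with
  | zero => exact hFG [] rfl trivial
  | succ t ih =>
    refine ih fun h hl hc => Finset.sum_le_sum fun r _ => ?_
    exact mul_le_mul_of_nonneg_left (hFG _ (by simp [hl]) ⟨rfl, hc⟩) (nullRew_pos h0 h1 r).le

theorem nullExp_linear {n : ℕ} {Δ : ℝ} (A : List (Fin n × Bool) → Fin n) (t : ℕ) (x y : ℝ)
    (F G : List (Fin n × Bool) → ℝ) :
    nullExp Δ A t (fun h => x * F h + y * G h) = x * nullExp Δ A t F + y * nullExp Δ A t G := by
  induction t generalizing F G with
  | zero => rfl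
  | succ t ih =>
    simp only [nullExp]
    rw [← ih]
    congr 1
    funext h
    simp only [Fintype.sum_bool]
    ring

theorem nullExp_const {n : ℕ} {Δ : ℝ} (A : List (Fin n × Bool) → Fin n) (t : ℕ) (x : ℝ) :
    nullExp Δ A t (fun _ => x) = x := by
  induction t with
  | zero => rfl
  | succ t ih =>
    simp only [nullExp, Fintype.sum_bool]
    rw [← ih]
    congr 1
    funext h
    rw [ih]
    simp [nullRew]
    ring

/-! ### Mutual information of a deterministic policy -/

/-- Information density of a history. -/
def infoDensity {n : ℕ} (Δ : ℝ) (h : List (Fin n × Bool)) : ℝ :=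
  ∑ a : Fin n, (n : ℝ)⁻¹ * (likeRatio Δ a h *
    Real.log (likeRatio Δ a h / ((n : ℝ)⁻¹ * ∑ b : Fin n, likeRatio Δ b h)))

/-- Total likelihood ratio of the arms other than the one about to be pulled. -/
def restRatio {n : ℕ} (Δ : ℝ) (A : List (Fin n × Bool) → Fin n) (h : List (Fin n × Bool)) : ℝ :=
  ∑ b ∈ Finset.univ.erase (A h), likeRatio Δ b h

/-- Likelihood ratio of the arm about to be pulled. -/
def curRatio {n : ℕ} (Δ : ℝ) (A : List (Fin n × Bool) → Fin n) (h : List (Fin n × Bool)) : ℝ :=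
  likeRatio Δ (A h) h

theorem mutualInfo_detAlg {n : ℕ} {Δ : ℝ} (h0 : 0 < Δ) (h1 : Δ < 1)
    (A : List (Fin n × Bool) → Fin n) (t : ℕ) :
    mutualInfo n t (detAlg A) Δ = nullExp Δ A t (infoDensity Δ) := by
  rw [← sum_nullHist, mutualInfo, Finset.sum_comm]
  refine Finset.sum_congr rfl fun h _ => ?_
  refine Eq.trans (Finset.sum_congr rfl fun a _ => ?_) (Finset.mul_sum _ _ _).symm
  simp only [histP_detAlg h0 h1, ← Finset.mul_sum]
  rcases (nullHist_nonneg h0 h1 A (hist h)).eq_or_lt with hw | hw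
  · simp [← hw]
  · rw [mul_left_comm (n : ℝ)⁻¹ (nullHist Δ A (hist h)) (∑ b, likeRatio Δ b (hist h)),
      mul_div_mul_left _ _ hw.ne']
    ring

theorem infoDensity_eq {n : ℕ} {Δ : ℝ} (h0 : 0 < Δ) (h1 : Δ < 1) (a : Fin n)
    (h : List (Fin n × Bool)) :
    infoDensity Δ h = (n : ℝ)⁻¹ * (∑ b ∈ Finset.univ.erase a,
        likeRatio Δ b h * Real.log (likeRatio Δ b h) +
      likeRatio Δ a h * Real.log (likeRatio Δ a h) -
      (∑ b ∈ Finset.univ.erase a, likeRatio Δ b h + likeRatio Δ a h) *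
        Real.log (∑ b ∈ Finset.univ.erase a, likeRatio Δ b h + likeRatio Δ a h) +
      (∑ b ∈ Finset.univ.erase a, likeRatio Δ b h + likeRatio Δ a h) * Real.log n) := by
  have hn : (0 : ℝ) < n := by exact_mod_cast a.pos
  rw [Finset.sum_erase_add _ (fun b => likeRatio Δ b h * Real.log (likeRatio Δ b h))
      (Finset.mem_univ a),
    Finset.sum_erase_add _ (fun b => likeRatio Δ b h) (Finset.mem_univ a),
    infoDensity, ← Finset.mul_sum]
  have hS : 0 < ∑ b : Fin n, likeRatio Δ b h :=
    Finset.sum_pos (fun b _ => likeRatio_pos h0 h1 b h) ⟨a, Finset.mem_univ a⟩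
  congr 1
  have e : ∀ b : Fin n, likeRatio Δ b h *
      Real.log (likeRatio Δ b h / ((n : ℝ)⁻¹ * ∑ b : Fin n, likeRatio Δ b h)) =
      likeRatio Δ b h * Real.log (likeRatio Δ b h) + likeRatio Δ b h *
        (Real.log n - Real.log (∑ b : Fin n, likeRatio Δ b h)) := by
    intro b
    rw [Real.log_div (likeRatio_pos h0 h1 b h).ne' (by positivity),
      Real.log_mul (by positivity) hS.ne', Real.log_inv]
    ring
  simp only [e]
  rw [Finset.sum_add_distrib, ← Finset.sum_mul]
  ring

theorem infoDensity_step {n : ℕ} {Δ : ℝ} (h0 : 0 < Δ) (h1 : Δ < 1)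
    (A : List (Fin n × Bool) → Fin n) (h : List (Fin n × Bool)) :
    infoDensity Δ h + Δ ^ 2 / n *
        (curRatio Δ A h * restRatio Δ A h / (restRatio Δ A h + curRatio Δ A h)) ≤
      ∑ r : Bool, nullRew Δ r * infoDensity Δ ((A h, r) :: h) := by
  have hn : (0 : ℝ) < n := by exact_mod_cast (A h).pos
  have hrest : ∀ (r : Bool), ∀ b ∈ Finset.univ.erase (A h),
      likeRatio Δ b ((A h, r) :: h) = likeRatio Δ b h := by
    intro r b hb
    simp [likeRatio, (Finset.ne_of_mem_erase hb).symm]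
  have hstep := entropy_step h0 h1 (likeRatio_pos h0 h1 (A h) h)
    (Finset.sum_nonneg fun b (_ : b ∈ Finset.univ.erase (A h)) => (likeRatio_pos h0 h1 b h).le)
  have hsum : ∀ r, ∑ b ∈ Finset.univ.erase (A h), likeRatio Δ b ((A h, r) :: h) =
      ∑ b ∈ Finset.univ.erase (A h), likeRatio Δ b h :=
    fun r => Finset.sum_congr rfl (hrest r)
  have hsum' : ∀ r, ∑ b ∈ Finset.univ.erase (A h), likeRatio Δ b ((A h, r) :: h) *
        Real.log (likeRatio Δ b ((A h, r) :: h)) =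
      ∑ b ∈ Finset.univ.erase (A h), likeRatio Δ b h * Real.log (likeRatio Δ b h) :=
    fun r => Finset.sum_congr rfl fun b hb => by rw [hrest r b hb]
  have hcur : ∀ r, likeRatio Δ (A h) ((A h, r) :: h) = likeRatio Δ (A h) h * rewRatio Δ r := by
    intro r; simp [likeRatio, mul_comm]
  rw [Fintype.sum_bool]
  simp only [infoDensity_eq h0 h1 (A h), hsum, hsum', hcur, curRatio, restRatio]
  simp only [nullRew, rewRatio, if_true, Bool.false_eq_true, if_false]
  have hR1 : (1 - Δ) / 2 * ((1 + Δ) / (1 - Δ)) + (1 + Δ) / 2 * ((1 - Δ) / (1 + Δ)) = 1 := by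
    have : 1 - Δ ≠ 0 := by linarith
    have : 1 + Δ ≠ 0 := by linarith
    field_simp; ring
  generalize likeRatio Δ (A h) h = l at *
  generalize ∑ b ∈ Finset.univ.erase (A h), likeRatio Δ b h = T at *
  generalize ∑ b ∈ Finset.univ.erase (A h), likeRatio Δ b h * Real.log (likeRatio Δ b h) = K at *
  have h2 := mul_le_mul_of_nonneg_left hstep (inv_nonneg.2 hn.le)
  have h3 : (n : ℝ)⁻¹ * (l * Real.log n *
    ((1 - Δ) / 2 * ((1 + Δ) / (1 - Δ)) + (1 + Δ) / 2 * ((1 - Δ) / (1 + Δ)))) =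
    (n : ℝ)⁻¹ * (l * Real.log n * 1) := by rw [hR1]
  rw [div_eq_inv_mul (Δ ^ 2)]
  generalize (1 + Δ) / (1 - Δ) = R at *
  generalize (1 - Δ) / (1 + Δ) = R' at *
  linarith

theorem le_nullExp_infoDensity {n : ℕ} {Δ : ℝ} (h0 : 0 < Δ) (h1 : Δ < 1)
    (A : List (Fin n × Bool) → Fin n) (t : ℕ) :
    Δ ^ 2 / n * ∑ s ∈ Finset.range t, nullExp Δ A s (fun h =>
        curRatio Δ A h * restRatio Δ A h / (restRatio Δ A h + curRatio Δ A h)) ≤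
      nullExp Δ A t (infoDensity Δ) := by
  induction t with
  | zero =>
    have hn : (n : ℝ) ≠ 0 := by exact_mod_cast (A []).pos.ne'
    simp [nullExp, infoDensity, likeRatio, hn]
  | succ t ih =>
    rw [Finset.sum_range_succ, mul_add, nullExp]
    have h := nullExp_mono (t := t) h0 h1 fun h _ (_ : Compat A h) => infoDensity_step h0 h1 A h
    have h2 := nullExp_linear (Δ := Δ) A t 1 (Δ ^ 2 / n) (infoDensity Δ) (fun h =>
        curRatio Δ A h * restRatio Δ A h / (restRatio Δ A h + curRatio Δ A h))
    simp only [one_mul] at h2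
    linarith

theorem histP_mem_Icc {n : ℕ} {Δ : ℝ} (h0 : 0 < Δ) (h1 : Δ < 1)
    {alg : List (Fin n × Bool) → Fin n → ℝ} (halg : IsAlg n alg) (b : Fin n)
    (h : List (Fin n × Bool)) : histP n alg Δ b h ∈ Set.Icc (0 : ℝ) 1 := by
  induction h with
  | nil => simp [histP]
  | cons x h ih =>
    obtain ⟨a, r⟩ := x
    have ha : alg h a ≤ 1 := by
      rw [← (halg h).2]
      exact Finset.single_le_sum (fun b _ => (halg h).1 b) (Finset.mem_univ a)
    have hr : 0 ≤ rewP n Δ b a r ∧ rewP n Δ b a r ≤ 1 := by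
      unfold rewP
      split_ifs <;> constructor <;> linarith
    have ha0 := (halg h).1 a
    exact ⟨mul_nonneg (mul_nonneg ih.1 ha0) hr.1,
      mul_le_one₀ (mul_le_one₀ ih.2 ha0 ha) hr.1 hr.2⟩

theorem bddAbove_mutualInfo {n : ℕ} (hn : 0 < n) {Δ : ℝ} (h0 : 0 < Δ) (h1 : Δ < 1) (t : ℕ) :
    BddAbove {x : ℝ | ∃ alg, IsAlg n alg ∧ x = mutualInfo n t alg Δ} := by
  refine ⟨∑ _a : Fin n, ∑ _h : Fin t → Fin n × Bool, (n : ℝ)⁻¹ * Real.log n, ?_⟩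
  rintro _ ⟨alg, halg, rfl⟩
  refine Finset.sum_le_sum fun a _ => Finset.sum_le_sum fun h _ => ?_
  have hn' : (1 : ℝ) ≤ n := by exact_mod_cast hn
  have hlog := Real.log_nonneg hn'
  have hP := fun b => histP_mem_Icc h0 h1 halg b (hist h)
  rcases (hP a).1.eq_or_lt with hz | hz
  · rw [← hz]; simp; positivity
  have hle : histP n alg Δ a (hist h) ≤ ∑ b : Fin n, histP n alg Δ b (hist h) :=
    Finset.single_le_sum (fun b _ => (hP b).1) (Finset.mem_univ a)
  have hS := hz.trans_le hle
  have hlog2 : Real.log (histP n alg Δ a (hist h) /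
      ((n : ℝ)⁻¹ * ∑ b : Fin n, histP n alg Δ b (hist h))) ≤ Real.log n := by
    refine Real.log_le_log (by positivity) ?_
    rw [div_le_iff₀ (by positivity)]
    rw [← mul_assoc, mul_inv_cancel₀ (by positivity), one_mul]
    exact hle
  calc _ ≤ (n : ℝ)⁻¹ * histP n alg Δ a (hist h) * Real.log n :=
        mul_le_mul_of_nonneg_left hlog2 (by positivity)
    _ ≤ (n : ℝ)⁻¹ * 1 * Real.log n := by
        have := (hP a).2
        gcongr
    _ = _ := by ring

/-! ### Moments of one reward -/

/-- Hellinger affinity of the two reward distributions. -/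
def affinity (Δ : ℝ) : ℝ := √(1 + Δ) * √(1 - Δ)

theorem affinity_nonneg (Δ : ℝ) : 0 ≤ affinity Δ := by unfold affinity; positivity

theorem affinity_le {Δ : ℝ} (h0 : 0 < Δ) (h1 : Δ < 1) : affinity Δ ≤ 1 - Δ ^ 2 / 2 := by
  refine abs_le_of_sq_le_sq' ?_ (by nlinarith) |>.2
  rw [affinity, mul_pow, Real.sq_sqrt (by linarith), Real.sq_sqrt (by linarith)]
  nlinarith [sq_nonneg (Δ ^ 2)]

theorem sum_nullRew_mul_sqrt {Δ : ℝ} (h0 : 0 < Δ) (h1 : Δ < 1) :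
    ∑ r : Bool, nullRew Δ r * √(rewRatio Δ r) = affinity Δ := by
  have ha := Real.sqrt_pos.2 (show 0 < 1 + Δ by linarith)
  have hb := Real.sqrt_pos.2 (show 0 < 1 - Δ by linarith)
  have ha2 := Real.sq_sqrt (show 0 ≤ 1 + Δ by linarith)
  have hb2 := Real.sq_sqrt (show 0 ≤ 1 - Δ by linarith)
  simp only [Fintype.sum_bool, nullRew, rewRatio, if_true, Bool.false_eq_true, if_false]
  rw [Real.sqrt_div (by linarith), Real.sqrt_div (by linarith), affinity]
  generalize √(1 + Δ) = a at *
  generalize √(1 - Δ) = b at *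
  rw [← ha2, ← hb2]
  field_simp
  ring

theorem sum_nullRew_mul_rewRatio {Δ : ℝ} (h0 : 0 < Δ) (h1 : Δ < 1) :
    ∑ r : Bool, nullRew Δ r * rewRatio Δ r = 1 := by
  have : 1 - Δ ≠ 0 := by linarith
  have : 1 + Δ ≠ 0 := by linarith
  simp only [Fintype.sum_bool, nullRew, rewRatio, if_true, Bool.false_eq_true, if_false]
  field_simp
  ring

theorem sum_nullRew_mul_sq {Δ : ℝ} (h0 : 0 < Δ) (h1 : Δ < 1) :
    ∑ r : Bool, nullRew Δ r * rewRatio Δ r ^ 2 = 1 + 4 * Δ ^ 2 / (1 - Δ ^ 2) := by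
  have : 1 - Δ ≠ 0 := by linarith
  have : 1 + Δ ≠ 0 := by linarith
  have : 1 - Δ ^ 2 ≠ 0 := by nlinarith
  simp only [Fintype.sum_bool, nullRew, rewRatio, if_true, Bool.false_eq_true, if_false]
  field_simp
  ring

theorem sum_nullRew {Δ : ℝ} : ∑ r : Bool, nullRew Δ r = 1 := by
  simp [nullRew]
  ring

theorem curRatio_pos {n : ℕ} {Δ : ℝ} (h0 : 0 < Δ) (h1 : Δ < 1)
    (A : List (Fin n × Bool) → Fin n) (h : List (Fin n × Bool)) : 0 < curRatio Δ A h :=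
  likeRatio_pos h0 h1 _ h

/-! ### The block policy -/

/-- Index of the arm pulled by the block policy: after each block of `m` pulls, the current arm is
replaced by the next one if its likelihood ratio is below one. -/
def armIdx (n : ℕ) [NeZero n] (Δ : ℝ) (m : ℕ) : List (Fin n × Bool) → ℕ
  | [] => 0
  | x :: h =>
    if m ∣ h.length + 1 ∧ likeRatio Δ (Fin.ofNat n (armIdx n Δ m h)) (x :: h) < 1 then
      armIdx n Δ m h + 1
    else armIdx n Δ m h

/-- The block policy. -/
def blockArm (n : ℕ) [NeZero n] (Δ : ℝ) (m : ℕ) (h : List (Fin n × Bool)) : Fin n :=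
  Fin.ofNat n (armIdx n Δ m h)

theorem truncation_le {l T b D : ℝ} (hl : 0 < l) (hb : 0 < b) (hD : 0 < D) (hT : b ≤ T) :
    1 / (1 + D) * l + -(1 / ((1 + D) * (D * b))) * l ^ 2 ≤ l * T / (T + l) := by
  have hT0 : 0 < T := hb.trans_le hT
  have e : 1 / (1 + D) * l + -(1 / ((1 + D) * (D * b))) * l ^ 2 =
      l * (D * b - l) / ((1 + D) * (D * b)) := by
    field_simp
    ring
  rw [e]
  rcases le_total (D * b) l with h | h
  · calc l * (D * b - l) / ((1 + D) * (D * b)) ≤ 0 :=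
          div_nonpos_of_nonpos_of_nonneg (by nlinarith) (by positivity)
      _ ≤ _ := by positivity
  · rw [div_le_div_iff₀ (by positivity) (by positivity), mul_assoc, mul_assoc]
    refine mul_le_mul_of_nonneg_left ?_ hl.le
    have h1 : l ≤ D * T := h.trans (by gcongr)
    calc (D * b - l) * (T + l) ≤ D * b * ((1 + D) * T) :=
          mul_le_mul (by linarith) (by linarith) (by linarith) (by positivity)
      _ = _ := by ring

section BlockPolicy

theorem succ_mod_of_not_dvd {s m : ℕ} (hm : ¬ m ∣ s + 1) : (s + 1) % m = s % m + 1 := by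
  have h1 := Nat.div_add_mod (s + 1) m
  have h2 := Nat.div_add_mod s m
  rw [Nat.succ_div_of_not_dvd hm] at h1
  omega

theorem mod_add_one_of_dvd {s m : ℕ} (hm : m ∣ s + 1) : s % m + 1 = m := by
  have h1 := Nat.div_add_mod (s + 1) m
  have h2 := Nat.div_add_mod s m
  rw [Nat.succ_div_of_dvd hm, Nat.mod_eq_zero_of_dvd hm, mul_add] at h1
  omega
variable {n : ℕ} [NeZero n] {Δ : ℝ} {m : ℕ}

theorem armIdx_le (h : List (Fin n × Bool)) : armIdx n Δ m h ≤ h.length / m := by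
  induction h with
  | nil => simp [armIdx]
  | cons x h ih =>
    rw [armIdx, List.length_cons, Nat.succ_div]
    split_ifs <;> omega

theorem likeRatio_of_armIdx_lt {h : List (Fin n × Bool)} (hc : Compat (blockArm n Δ m) h)
    {b : Fin n} (hb : armIdx n Δ m h < b) : likeRatio Δ b h = 1 := by
  induction h with
  | nil => rfl
  | cons x h ih =>
    obtain ⟨a, r⟩ := x
    obtain ⟨rfl, hc⟩ := hc
    have hb' : armIdx n Δ m h < b := by
      rw [armIdx] at hb
      split_ifs at hb <;> omega
    have hne : blockArm n Δ m h ≠ b := by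
      intro he
      have := Nat.mod_le (armIdx n Δ m h) n
      rw [← he] at hb'
      simp only [blockArm, Fin.val_ofNat] at hb'
      omega
    simp [likeRatio, hne, ih hc hb']

theorem curRatio_cons {h : List (Fin n × Bool)} (hc : Compat (blockArm n Δ m) h)
    (hlt : (h.length + 1) / m < n) (r : Bool) :
    curRatio Δ (blockArm n Δ m) ((blockArm n Δ m h, r) :: h) =
      if m ∣ h.length + 1 then max (curRatio Δ (blockArm n Δ m) h * rewRatio Δ r) 1
      else curRatio Δ (blockArm n Δ m) h * rewRatio Δ r := by
  have hkeep : likeRatio Δ (blockArm n Δ m h) ((blockArm n Δ m h, r) :: h) =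
      curRatio Δ (blockArm n Δ m) h * rewRatio Δ r := by
    simp [likeRatio, curRatio, mul_comm]
  by_cases hm : m ∣ h.length + 1
  · rw [if_pos hm]
    by_cases hl : likeRatio Δ (blockArm n Δ m h) ((blockArm n Δ m h, r) :: h) < 1
    · have hidx : armIdx n Δ m ((blockArm n Δ m h, r) :: h) = armIdx n Δ m h + 1 := by
        rw [armIdx, if_pos ⟨hm, hl⟩]
      have hle := armIdx_le (Δ := Δ) (m := m) ((blockArm n Δ m h, r) :: h)
      rw [hidx, List.length_cons] at hle
      have hval : ((Fin.ofNat n (armIdx n Δ m h + 1) : Fin n) : ℕ) = armIdx n Δ m h + 1 := by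
        rw [Fin.val_ofNat, Nat.mod_eq_of_lt (by omega)]
      have hne : blockArm n Δ m h ≠ Fin.ofNat n (armIdx n Δ m h + 1) := by
        intro he
        have := congrArg Fin.val he
        rw [hval, blockArm, Fin.val_ofNat] at this
        have := Nat.mod_le (armIdx n Δ m h) n
        omega
      rw [max_eq_right (by rw [← hkeep]; exact hl.le), curRatio, blockArm, hidx]
      have := likeRatio_of_armIdx_lt hc (b := Fin.ofNat n (armIdx n Δ m h + 1))
        (by rw [hval]; omega)
      rw [likeRatio, if_neg hne, this, one_mul]
    · have hidx : armIdx n Δ m ((blockArm n Δ m h, r) :: h) = armIdx n Δ m h := by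
        rw [armIdx, if_neg (fun hh => hl hh.2)]
      rw [max_eq_left (by rw [← hkeep]; exact not_lt.1 hl), curRatio, ← hkeep]
      congr 1
      rw [blockArm, hidx, blockArm]
  · have hidx : armIdx n Δ m ((blockArm n Δ m h, r) :: h) = armIdx n Δ m h := by
      rw [armIdx, if_neg (fun hh => hm hh.1)]
    rw [if_neg hm, curRatio, ← hkeep]
    congr 1
    rw [blockArm, hidx, blockArm]

theorem le_restRatio (h0 : 0 < Δ) (h1 : Δ < 1) {h : List (Fin n × Bool)}
    (hc : Compat (blockArm n Δ m) h) (hlt : h.length / m < n) :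
    (n : ℝ) - 1 - (h.length / m : ℕ) ≤ restRatio Δ (blockArm n Δ m) h := by
  have hle := armIdx_le (Δ := Δ) (m := m) h
  have hval : (blockArm n Δ m h : ℕ) = armIdx n Δ m h := by
    rw [blockArm, Fin.val_ofNat, Nat.mod_eq_of_lt (by omega)]
  calc (n : ℝ) - 1 - (h.length / m : ℕ) ≤ (n - 1 - armIdx n Δ m h : ℕ) := by
        rw [sub_sub, sub_le_iff_le_add]
        norm_cast
        omega
    _ = ∑ _b ∈ Finset.Ioi (blockArm n Δ m h), (1 : ℝ) := by
        simp [hval]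
    _ = ∑ b ∈ Finset.Ioi (blockArm n Δ m h), likeRatio Δ b h := by
        refine Finset.sum_congr rfl fun b hb => (likeRatio_of_armIdx_lt hc ?_).symm
        have : blockArm n Δ m h < b := Finset.mem_Ioi.1 hb
        rwa [← hval]
    _ ≤ _ := by
        refine Finset.sum_le_sum_of_subset_of_nonneg ?_ fun b _ _ => (likeRatio_pos h0 h1 b h).le
        intro b hb
        simp [(Finset.mem_Ioi.1 hb).ne']

theorem le_nullExp_sqrt (h0 : 0 < Δ) (h1 : Δ < 1) {s : ℕ} (hs : s / m < n) :
    affinity Δ ^ (s % m) ≤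
      nullExp Δ (blockArm n Δ m) s fun h => √(curRatio Δ (blockArm n Δ m) h) := by
  induction s with
  | zero => simp [nullExp, curRatio, likeRatio]
  | succ s ih =>
    rw [nullExp]
    by_cases hm : m ∣ s + 1
    · rw [Nat.mod_eq_zero_of_dvd hm, pow_zero, ← nullExp_const (Δ := Δ) (blockArm n Δ m) s 1]
      refine nullExp_mono h0 h1 fun h hl hc => ?_
      rw [← sum_nullRew (Δ := Δ)]
      refine Finset.sum_le_sum fun r _ => le_mul_of_one_le_right (nullRew_pos h0 h1 r).le ?_
      rw [curRatio_cons hc (by rwa [hl]), hl, if_pos hm]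
      exact Real.one_le_sqrt.2 (le_max_right _ _)
    · have hs' : s / m < n := by rwa [Nat.succ_div_of_not_dvd hm] at hs
      have hmod := succ_mod_of_not_dvd hm
      calc affinity Δ ^ ((s + 1) % m) = affinity Δ * affinity Δ ^ (s % m) + 0 := by
            rw [hmod, pow_succ']; ring
        _ ≤ affinity Δ * nullExp Δ (blockArm n Δ m) s
              (fun h => √(curRatio Δ (blockArm n Δ m) h)) + 0 := by
            gcongr
            exacts [affinity_nonneg Δ, ih hs']
        _ = nullExp Δ (blockArm n Δ m) s (fun h =>
              affinity Δ * √(curRatio Δ (blockArm n Δ m) h) + 0 * 0) := by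
            rw [nullExp_linear]; simp
        _ ≤ _ := nullExp_mono h0 h1 fun h hl hc => by
            rw [← sum_nullRew_mul_sqrt h0 h1, Finset.sum_mul, mul_zero, add_zero]
            refine (Finset.sum_congr rfl fun r _ => ?_).le
            rw [curRatio_cons hc (by rwa [hl]), hl, if_neg hm,
              Real.sqrt_mul (curRatio_pos h0 h1 _ h).le]
            ring

theorem le_nullExp_sub_sqrt (h0 : 0 < Δ) (h1 : Δ < 1) {s : ℕ} (hs : s / m < n) :
    (1 - affinity Δ ^ m) * (s / m : ℕ) + 1 - affinity Δ ^ (s % m) ≤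
      nullExp Δ (blockArm n Δ m) s fun h =>
        curRatio Δ (blockArm n Δ m) h - √(curRatio Δ (blockArm n Δ m) h) := by
  induction s with
  | zero => simp [nullExp, curRatio, likeRatio]
  | succ s ih =>
    have hs' : s / m < n := (Nat.div_le_div_right (Nat.le_succ s)).trans_lt hs
    have hρ1 : affinity Δ ≤ 1 := (affinity_le h0 h1).trans (by nlinarith)
    have hdrift : (1 - affinity Δ ^ m) * (s / m : ℕ) + 1 - affinity Δ ^ (s % m + 1) ≤
        nullExp Δ (blockArm n Δ m) s fun h => ∑ r : Bool, nullRew Δ r *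
          (curRatio Δ (blockArm n Δ m) h * rewRatio Δ r -
            √(curRatio Δ (blockArm n Δ m) h * rewRatio Δ r)) := by
      have e : (fun h => ∑ r : Bool, nullRew Δ r *
          (curRatio Δ (blockArm n Δ m) h * rewRatio Δ r -
            √(curRatio Δ (blockArm n Δ m) h * rewRatio Δ r))) = fun h =>
          1 * (curRatio Δ (blockArm n Δ m) h - √(curRatio Δ (blockArm n Δ m) h)) +
            (1 - affinity Δ) * √(curRatio Δ (blockArm n Δ m) h) := by
        funext h
        have e1 := sum_nullRew_mul_rewRatio h0 h1
        have e2 := sum_nullRew_mul_sqrt h0 h1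
        simp only [Real.sqrt_mul (curRatio_pos h0 h1 _ h).le]
        simp only [Fintype.sum_bool] at e1 e2 ⊢
        linear_combination (curRatio Δ (blockArm n Δ m) h) * e1 -
          √(curRatio Δ (blockArm n Δ m) h) * e2
      rw [e, nullExp_linear]
      have h3 := mul_le_mul_of_nonneg_left (le_nullExp_sqrt h0 h1 hs') (sub_nonneg.2 hρ1)
      have h4 := ih hs'
      rw [pow_succ]
      linarith
    rw [nullExp]
    have hle : nullExp Δ (blockArm n Δ m) s (fun h => ∑ r : Bool, nullRew Δ r *
          (curRatio Δ (blockArm n Δ m) h * rewRatio Δ r -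
            √(curRatio Δ (blockArm n Δ m) h * rewRatio Δ r))) ≤
        nullExp Δ (blockArm n Δ m) s fun h => ∑ r : Bool, nullRew Δ r *
          (curRatio Δ (blockArm n Δ m) ((blockArm n Δ m h, r) :: h) -
            √(curRatio Δ (blockArm n Δ m) ((blockArm n Δ m h, r) :: h))) := by
      refine nullExp_mono h0 h1 fun h hl hc => Finset.sum_le_sum fun r _ =>
        mul_le_mul_of_nonneg_left ?_ (nullRew_pos h0 h1 r).le
      rw [curRatio_cons hc (by rwa [hl]), hl]
      split_ifs
      · have hy := mul_pos (curRatio_pos h0 h1 (blockArm n Δ m) h) (rewRatio_pos h0 h1 r)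
        rcases le_total 1 (curRatio Δ (blockArm n Δ m) h * rewRatio Δ r) with hx | hx
        · rw [max_eq_left hx]
        · rw [max_eq_right hx, Real.sqrt_one, sub_self, sub_nonpos]
          exact Real.le_sqrt_of_sq_le (by nlinarith)
      · exact le_rfl
    refine le_trans ?_ (hdrift.trans hle)
    by_cases hm : m ∣ s + 1
    · rw [Nat.mod_eq_zero_of_dvd hm, Nat.succ_div_of_dvd hm, mod_add_one_of_dvd hm]
      push_cast
      linarith
    · rw [Nat.succ_div_of_not_dvd hm, succ_mod_of_not_dvd hm]

theorem le_nullExp_curRatio (h0 : 0 < Δ) (h1 : Δ < 1) {s : ℕ} (hs : s / m < n) :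
    1 + (1 - affinity Δ ^ m) * (s / m : ℕ) ≤
      nullExp Δ (blockArm n Δ m) s (curRatio Δ (blockArm n Δ m)) := by
  have h2 := le_nullExp_sqrt h0 h1 hs
  have h3 := le_nullExp_sub_sqrt h0 h1 hs
  have h4 := nullExp_linear (Δ := Δ) (blockArm n Δ m) s 1 1
    (fun h => curRatio Δ (blockArm n Δ m) h - √(curRatio Δ (blockArm n Δ m) h))
    (fun h => √(curRatio Δ (blockArm n Δ m) h))
  simp only [one_mul, sub_add_cancel] at h4
  change nullExp Δ (blockArm n Δ m) s (curRatio Δ (blockArm n Δ m)) = _ at h4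
  linarith

theorem nullExp_sq_le (h0 : 0 < Δ) (h1 : Δ < 1) {s : ℕ} (hs : s / m < n) :
    nullExp Δ (blockArm n Δ m) s (fun h => curRatio Δ (blockArm n Δ m) h ^ 2) ≤
      ((s / m : ℕ) + 1) * (1 + 4 * Δ ^ 2 / (1 - Δ ^ 2)) ^ s := by
  have hC : 1 ≤ 1 + 4 * Δ ^ 2 / (1 - Δ ^ 2) :=
    le_add_of_nonneg_right (div_nonneg (by positivity) (by nlinarith))
  set C := 1 + 4 * Δ ^ 2 / (1 - Δ ^ 2) with hCd
  induction s with
  | zero => simp [nullExp, curRatio, likeRatio]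
  | succ s ih =>
    have hs' : s / m < n := (Nat.div_le_div_right (Nat.le_succ s)).trans_lt hs
    have hstep : nullExp Δ (blockArm n Δ m) (s + 1)
          (fun h => curRatio Δ (blockArm n Δ m) h ^ 2) ≤
        C * nullExp Δ (blockArm n Δ m) s (fun h => curRatio Δ (blockArm n Δ m) h ^ 2) +
          (if m ∣ s + 1 then 1 else 0) := by
      calc _ ≤ nullExp Δ (blockArm n Δ m) s (fun h =>
            C * curRatio Δ (blockArm n Δ m) h ^ 2 + (if m ∣ s + 1 then 1 else 0) * 1) := ?_
        _ = _ := by rw [nullExp_linear, nullExp_const, mul_one]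
      rw [nullExp]
      refine nullExp_mono h0 h1 fun h hl hc => ?_
      rw [hCd, ← sum_nullRew_mul_sq h0 h1, Finset.sum_mul, ← sum_nullRew (Δ := Δ),
        Finset.mul_sum, ← Finset.sum_add_distrib, sum_nullRew]
      refine Finset.sum_le_sum fun r _ => ?_
      have hq := (nullRew_pos h0 h1 r).le
      have : curRatio Δ (blockArm n Δ m) ((blockArm n Δ m h, r) :: h) ^ 2 ≤
          (curRatio Δ (blockArm n Δ m) h * rewRatio Δ r) ^ 2 + (if m ∣ s + 1 then 1 else 0) := by
        rw [curRatio_cons hc (by rwa [hl]), hl]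
        split_ifs
        · rcases le_total 1 (curRatio Δ (blockArm n Δ m) h * rewRatio Δ r) with hx | hx
          · rw [max_eq_left hx]; linarith
          · rw [max_eq_right hx]; nlinarith [sq_nonneg (curRatio Δ (blockArm n Δ m) h * rewRatio Δ r)]
        · simp
      calc _ ≤ nullRew Δ r * ((curRatio Δ (blockArm n Δ m) h * rewRatio Δ r) ^ 2 +
            (if m ∣ s + 1 then 1 else 0)) := mul_le_mul_of_nonneg_left this hq
        _ = _ := by ring
    refine hstep.trans ?_
    have hmul := mul_le_mul_of_nonneg_left (ih hs') (zero_le_one.trans hC)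
    have hpow : 1 ≤ C ^ (s + 1) := one_le_pow₀ hC
    rw [Nat.succ_div]
    split_ifs
    · push_cast
      rw [pow_succ] at *
      linarith
    · rw [pow_succ]
      simp only [add_zero]
      linarith

theorem le_nullExp_gain (h0 : 0 < Δ) (h1 : Δ < 1) {s : ℕ} (hs : s / m < n) {b D : ℝ} (hb : 0 < b)
    (hD : 0 < D) (hbn : b ≤ (n : ℝ) - 1 - (s / m : ℕ))
    (hsq : ((s / m : ℕ) + 1) * (1 + 4 * Δ ^ 2 / (1 - Δ ^ 2)) ^ s ≤ D * b / 2) :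
    (1 / 2 + (1 - affinity Δ ^ m) * (s / m : ℕ)) / (1 + D) ≤
      nullExp Δ (blockArm n Δ m) s fun h =>
        curRatio Δ (blockArm n Δ m) h * restRatio Δ (blockArm n Δ m) h /
          (restRatio Δ (blockArm n Δ m) h + curRatio Δ (blockArm n Δ m) h) := by
  have hlin := nullExp_linear (Δ := Δ) (blockArm n Δ m) s (1 / (1 + D)) (-(1 / ((1 + D) * (D * b))))
    (curRatio Δ (blockArm n Δ m)) (fun h => curRatio Δ (blockArm n Δ m) h ^ 2)
  have hmono := nullExp_mono (t := s) h0 h1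
    (F := fun h => 1 / (1 + D) * curRatio Δ (blockArm n Δ m) h +
      -(1 / ((1 + D) * (D * b))) * curRatio Δ (blockArm n Δ m) h ^ 2)
    (G := fun h => curRatio Δ (blockArm n Δ m) h * restRatio Δ (blockArm n Δ m) h /
          (restRatio Δ (blockArm n Δ m) h + curRatio Δ (blockArm n Δ m) h))
    (A := blockArm n Δ m) fun h hl hc => by
      have hT := hbn.trans (by simpa [hl] using le_restRatio h0 h1 hc (by rwa [hl]))
      exact truncation_le (curRatio_pos h0 h1 _ h) hb hD hT
  refine le_trans ?_ hmono
  rw [hlin]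
  have e1 := le_nullExp_curRatio h0 h1 hs
  have e2 := (nullExp_sq_le h0 h1 hs).trans hsq
  generalize nullExp Δ (blockArm n Δ m) s (curRatio Δ (blockArm n Δ m)) = X at *
  generalize nullExp Δ (blockArm n Δ m) s (fun h => curRatio Δ (blockArm n Δ m) h ^ 2) = Y at *
  have e3 : 1 / ((1 + D) * (D * b)) * Y ≤ 1 / ((1 + D) * (D * b)) * (D * b / 2) :=
    mul_le_mul_of_nonneg_left e2 (by positivity)
  have e4 : 1 / ((1 + D) * (D * b)) * (D * b / 2) = 1 / (1 + D) * (1 / 2) := by field_simp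
  have e5 := mul_le_mul_of_nonneg_left e1 (show 0 ≤ 1 / (1 + D) by positivity)
  rw [div_eq_mul_one_div, mul_comm]
  linarith

end BlockPolicy

theorem affinity_pow_le {Δ : ℝ} (h0 : 0 < Δ) (h1 : Δ < 1) {m : ℕ} (hm : 1 ≤ m * Δ ^ 2) :
    affinity Δ ^ m ≤ 2 / 3 := by
  have hexp : affinity Δ ≤ Real.exp (-(Δ ^ 2 / 2)) :=
    (affinity_le h0 h1).trans (by have := Real.add_one_le_exp (-(Δ ^ 2 / 2)); linarith)
  calc affinity Δ ^ m ≤ Real.exp (-(Δ ^ 2 / 2)) ^ m := pow_le_pow_left₀ (affinity_nonneg Δ) hexp m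
    _ = Real.exp (-(m * Δ ^ 2 / 2)) := by rw [← Real.exp_nat_mul]; congr 1; ring
    _ ≤ Real.exp (-(1 / 2)) := Real.exp_le_exp.2 (by linarith)
    _ ≤ 2 / 3 := by
      rw [Real.exp_neg, inv_le_comm₀ (Real.exp_pos _) (by norm_num)]
      have := Real.add_one_le_exp (1 / 2 : ℝ)
      linarith

theorem le_nullExp_gain_of_le {n : ℕ} [NeZero n] (hn : 2 ≤ n) {ε Δ : ℝ} (hε : 0 < ε) (hε1 : ε < 1)
    (h0 : 0 < Δ) (h1 : Δ ≤ 1 - ε) {m : ℕ} (hm : 1 ≤ m * Δ ^ 2) (hm2 : m * Δ ^ 2 ≤ 2) {s : ℕ}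
    (hs : s * Δ ^ 2 ≤ ε / 8 * Real.log n) :
    Δ ^ 2 / 54 * (s + 1) ≤ nullExp Δ (blockArm n Δ m) s fun h =>
        curRatio Δ (blockArm n Δ m) h * restRatio Δ (blockArm n Δ m) h /
          (restRatio Δ (blockArm n Δ m) h + curRatio Δ (blockArm n Δ m) h) := by
  have hΔ1 : Δ < 1 := by linarith
  have hn' : (2 : ℝ) ≤ n := by exact_mod_cast hn
  have hm0 : (0 : ℝ) < m := by
    rcases Nat.eq_zero_or_pos m with rfl | h
    · norm_num at hm
    · exact_mod_cast h
  have hlog0 : 0 ≤ Real.log n := Real.log_nonneg (by linarith)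
  have hlog1 : Real.log n ≤ n - 1 := Real.log_le_sub_one_of_pos (by linarith)
  have hq : ((s / m : ℕ) : ℝ) ≤ Real.log n / 8 := by
    have e : ((s / m : ℕ) : ℝ) ≤ s / m := Nat.cast_div_le
    have e2 : (s : ℝ) / m ≤ s * Δ ^ 2 := by
      rw [div_le_iff₀ hm0]
      have := mul_le_mul_of_nonneg_left hm (Nat.cast_nonneg (α := ℝ) s)
      linarith
    nlinarith
  have hlt : s / m < n := by
    have : ((s / m : ℕ) : ℝ) < n := by linarith
    exact_mod_cast this
  have hw : Real.exp (Real.log n / 2) * Real.exp (Real.log n / 2) = n := by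
    rw [← Real.exp_add, add_halves, Real.exp_log (by linarith)]
  have hpow : (1 + 4 * Δ ^ 2 / (1 - Δ ^ 2)) ^ s ≤ Real.exp (Real.log n / 2) := by
    have hden : ε ≤ 1 - Δ ^ 2 := by nlinarith
    have hχ : 4 * Δ ^ 2 / (1 - Δ ^ 2) ≤ 4 * Δ ^ 2 / ε := by gcongr
    have hχ0 : 0 ≤ 4 * Δ ^ 2 / (1 - Δ ^ 2) := div_nonneg (by positivity) (by linarith)
    calc (1 + 4 * Δ ^ 2 / (1 - Δ ^ 2)) ^ s ≤ Real.exp (4 * Δ ^ 2 / ε) ^ s := by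
          refine pow_le_pow_left₀ (by linarith) ?_ s
          have := Real.add_one_le_exp (4 * Δ ^ 2 / ε)
          linarith
      _ = Real.exp (4 / ε * (s * Δ ^ 2)) := by rw [← Real.exp_nat_mul]; congr 1; ring
      _ ≤ Real.exp (Real.log n / 2) := by
          refine Real.exp_le_exp.2 ?_
          calc 4 / ε * (s * Δ ^ 2) ≤ 4 / ε * (ε / 8 * Real.log n) := by gcongr
            _ = Real.log n / 2 := by field_simp; ring
  have hsq : ((s / m : ℕ) + 1) * (1 + 4 * Δ ^ 2 / (1 - Δ ^ 2)) ^ s ≤ 8 * ((n : ℝ) / 4) / 2 := by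
    have hone := Real.add_one_le_exp (Real.log n / 2)
    calc ((s / m : ℕ) + 1) * (1 + 4 * Δ ^ 2 / (1 - Δ ^ 2)) ^ s
        ≤ ((s / m : ℕ) + 1) * Real.exp (Real.log n / 2) := by gcongr
      _ ≤ Real.exp (Real.log n / 2) * Real.exp (Real.log n / 2) := by
          gcongr
          linarith
      _ = 8 * ((n : ℝ) / 4) / 2 := by rw [hw]; ring
  refine le_trans ?_ (le_nullExp_gain h0 hΔ1 hlt (by positivity) (by norm_num) (by linarith) hsq)
  have hρ := affinity_pow_le h0 hΔ1 hm
  have hs1 : (s : ℝ) + 1 ≤ m * ((s / m : ℕ) + 1) := by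
    have := Nat.lt_mul_div_succ s (show 0 < m by exact_mod_cast hm0)
    exact_mod_cast this
  have hq0 : (0 : ℝ) ≤ (s / m : ℕ) := Nat.cast_nonneg _
  generalize ((s / m : ℕ) : ℝ) = q at *
  have hA : (s + 1) * Δ ^ 2 ≤ 2 * (q + 1) :=
    calc (s + 1) * Δ ^ 2 ≤ m * (q + 1) * Δ ^ 2 := by gcongr
      _ = m * Δ ^ 2 * (q + 1) := by ring
      _ ≤ 2 * (q + 1) := by gcongr
  nlinarith

/-- Achievability for the mutual information, quadratic regime: for every `ε ∈ (0,1)` there is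
`c > 0` such that for all `n ≥ 2`, `Δ ∈ (0, 1-ε]` and horizons `1/Δ² < t ≤ (log n)/Δ²`,
`I*_t ≥ c t² Δ⁴ / n`. -/
theorem bandit_info_achievability_intermediate_t :
    ∀ ε : ℝ, ε ∈ Set.Ioo (0 : ℝ) 1 → ∃ c : ℝ, 0 < c ∧
      ∀ n : ℕ, 2 ≤ n → ∀ Δ : ℝ, Δ ∈ Set.Ioc (0 : ℝ) (1 - ε) →
        ∀ t : ℕ, 1 / Δ ^ 2 < (t : ℝ) → (t : ℝ) ≤ Real.log n / Δ ^ 2 →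
          c * (t : ℝ) ^ 2 * Δ ^ 4 / n ≤ IStar n t Δ := by
  rintro ε ⟨hε, hε1⟩
  refine ⟨(ε / 8) ^ 2 / 108, by positivity, ?_⟩
  rintro n hn Δ ⟨h0, hΔε⟩ t ht1 ht2
  have h1 : Δ < 1 := by linarith
  have : NeZero n := ⟨by omega⟩
  have hn0 : (0 : ℝ) < n := by exact_mod_cast (by omega : 0 < n)
  have hm : 1 ≤ (⌈1 / Δ ^ 2⌉₊ : ℝ) * Δ ^ 2 := by
    rw [← div_le_iff₀ (by positivity)]
    exact Nat.le_ceil _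
  have hm2 : (⌈1 / Δ ^ 2⌉₊ : ℝ) * Δ ^ 2 ≤ 2 := by
    have h := (Nat.ceil_lt_add_one (show 0 ≤ 1 / Δ ^ 2 by positivity)).le
    calc (⌈1 / Δ ^ 2⌉₊ : ℝ) * Δ ^ 2 ≤ (1 / Δ ^ 2 + 1) * Δ ^ 2 := by gcongr
      _ = 1 + Δ ^ 2 := by field_simp
      _ ≤ 2 := by nlinarith
  set m := ⌈1 / Δ ^ 2⌉₊
  rw [le_div_iff₀ (by positivity)] at ht2
  have ht0 : (1 : ℝ) ≤ t := by
    refine le_trans ?_ ht1.le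
    rw [le_div_iff₀ (by positivity)]
    nlinarith
  set N := ⌊ε / 8 * t⌋₊ + 1 with hN
  have hNt : N ≤ t := by
    have h : ⌊ε / 8 * t⌋₊ < t := by
      rw [Nat.floor_lt (by positivity)]
      nlinarith
    omega
  have hNge : ε / 8 * t ≤ N := by
    rw [hN]
    exact_mod_cast (Nat.lt_floor_add_one (ε / 8 * (t : ℝ))).le
  have hgain : ∀ s ∈ Finset.range N, Δ ^ 2 / 54 * ((s : ℝ) + 1) ≤
      nullExp Δ (blockArm n Δ m) s fun h =>
        curRatio Δ (blockArm n Δ m) h * restRatio Δ (blockArm n Δ m) h /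
          (restRatio Δ (blockArm n Δ m) h + curRatio Δ (blockArm n Δ m) h) := by
    intro s hs
    refine le_nullExp_gain_of_le hn hε hε1 h0 hΔε hm hm2 ?_
    have hsf : (s : ℝ) ≤ ε / 8 * t :=
      (Nat.le_floor_iff (by positivity)).1 (Nat.lt_succ_iff.1 (Finset.mem_range.1 hs))
    calc s * Δ ^ 2 ≤ ε / 8 * t * Δ ^ 2 := by gcongr
      _ = ε / 8 * (t * Δ ^ 2) := by ring
      _ ≤ ε / 8 * Real.log n := by gcongr
  have hnonneg : ∀ s, 0 ≤ nullExp Δ (blockArm n Δ m) s fun h =>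
        curRatio Δ (blockArm n Δ m) h * restRatio Δ (blockArm n Δ m) h /
          (restRatio Δ (blockArm n Δ m) h + curRatio Δ (blockArm n Δ m) h) := by
    intro s
    rw [← nullExp_const (Δ := Δ) (blockArm n Δ m) s 0]
    refine nullExp_mono h0 h1 fun h _ _ => ?_
    have hl := curRatio_pos h0 h1 (blockArm n Δ m) h
    have hT : 0 ≤ restRatio Δ (blockArm n Δ m) h :=
      Finset.sum_nonneg fun b _ => (likeRatio_pos h0 h1 b h).le
    positivity
  have hsum : ∀ K : ℕ, (K : ℝ) ^ 2 / 2 ≤ ∑ s ∈ Finset.range K, ((s : ℝ) + 1) := by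
    intro K
    induction K with
    | zero => simp
    | succ K ih => rw [Finset.sum_range_succ]; push_cast; nlinarith
  have hIStar : mutualInfo n t (detAlg (blockArm n Δ m)) Δ ≤ IStar n t Δ :=
    le_csSup (bddAbove_mutualInfo (by omega) h0 h1 t) ⟨_, isAlg_detAlg _, rfl⟩
  refine le_trans ?_ hIStar
  rw [mutualInfo_detAlg h0 h1]
  refine le_trans ?_ (le_nullExp_infoDensity h0 h1 _ t)
  calc (ε / 8) ^ 2 / 108 * (t : ℝ) ^ 2 * Δ ^ 4 / n
      = Δ ^ 2 / n * (Δ ^ 2 / 54 * ((ε / 8 * t) ^ 2 / 2)) := by ring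
    _ ≤ Δ ^ 2 / n * (Δ ^ 2 / 54 * ∑ s ∈ Finset.range N, ((s : ℝ) + 1)) := by
        gcongr
        refine le_trans ?_ (hsum N)
        gcongr
    _ ≤ Δ ^ 2 / n * ∑ s ∈ Finset.range t, _ := by
        rw [Finset.mul_sum]
        gcongr
        exact (Finset.sum_le_sum hgain).trans (Finset.sum_le_sum_of_subset_of_nonneg
          (Finset.range_mono hNt) fun s _ _ => hnonneg s)
end
end

section
/- For every ε ∈ (0,1) there exists a constant c > 0 such that for all integers n ≥ 2, all Δ ∈ (0, 1-ε], and all horizons t ∈ ℕ with (log n)/Δ² < t ≤ n/Δ², the optimal mutual information satisfies I*_t ≥ c·t·Δ²·(log n)/n. -/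
open scoped BigOperators

noncomputable section

namespace Bandit

variable {n : ℕ}

/-! ### Sums over histories -/

lemma hist_snoc {t : ℕ} (h : Fin t → Fin n × Bool) (x : Fin n × Bool) :
    hist (Fin.snoc h x : Fin (t + 1) → Fin n × Bool) = x :: hist h := by
  rw [hist, List.ofFn_succ']
  simp [hist]

lemma sum_hist_succ (t : ℕ) (F : List (Fin n × Bool) → ℝ) :
    ∑ h : Fin (t + 1) → Fin n × Bool, F (hist h) =
      ∑ h : Fin t → Fin n × Bool, ∑ x : Fin n × Bool, F (x :: hist h) := by
  rw [← (Fin.snocEquiv (fun _ : Fin (t + 1) => Fin n × Bool)).sum_comp, Fintype.sum_prod_type,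
    Finset.sum_comm]
  refine Finset.sum_congr rfl fun h _ => Finset.sum_congr rfl fun x _ => ?_
  rw [← hist_snoc]
  rfl

lemma sum_hist_zero (F : List (Fin n × Bool) → ℝ) :
    ∑ h : Fin 0 → Fin n × Bool, F (hist h) = F [] := by
  simp [hist]

lemma length_hist {t : ℕ} (h : Fin t → Fin n × Bool) : (hist h).length = t := by
  simp [hist]

lemma rewP_true (Δ : ℝ) (a j : Fin n) :
    rewP n Δ a j true = if j = a then (1 + Δ) / 2 else (1 - Δ) / 2 := by
  simp [rewP]

lemma rewP_false (Δ : ℝ) (a j : Fin n) :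
    rewP n Δ a j false = if j = a then (1 - Δ) / 2 else (1 + Δ) / 2 := by
  simp only [rewP]
  split_ifs <;> first | contradiction | ring

lemma rewP_pos {Δ : ℝ} (h0 : 0 < Δ) (h1 : Δ < 1) (a j : Fin n) (r : Bool) :
    0 < rewP n Δ a j r := by
  cases r
  · rw [rewP_false]; split_ifs <;> linarith
  · rw [rewP_true]; split_ifs <;> linarith

lemma rewP_le_one {Δ : ℝ} (h0 : 0 < Δ) (h1 : Δ < 1) (a j : Fin n) (r : Bool) :
    rewP n Δ a j r ≤ 1 := by
  cases r
  · rw [rewP_false]; split_ifs <;> linarith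
  · rw [rewP_true]; split_ifs <;> linarith

lemma rewP_add (Δ : ℝ) (a j : Fin n) : rewP n Δ a j true + rewP n Δ a j false = 1 := by
  rw [rewP_true, rewP_false]; split_ifs <;> ring

/-! ### The mutual information is at most `log n` -/

lemma histP_nonneg {alg : List (Fin n × Bool) → Fin n → ℝ} (halg : IsAlg n alg) {Δ : ℝ}
    (h0 : 0 < Δ) (h1 : Δ < 1) (a : Fin n) (l : List (Fin n × Bool)) :
    0 ≤ histP n alg Δ a l := by
  induction l with
  | nil => simp [histP]
  | cons x l ih =>
    exact mul_nonneg (mul_nonneg ih ((halg l).1 _)) (rewP_pos h0 h1 a _ _).le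

lemma sum_histP {alg : List (Fin n × Bool) → Fin n → ℝ} (halg : IsAlg n alg) (Δ : ℝ)
    (a : Fin n) (t : ℕ) :
    ∑ h : Fin t → Fin n × Bool, histP n alg Δ a (hist h) = 1 := by
  induction t with
  | zero => rw [sum_hist_zero]; rfl
  | succ t ih =>
    rw [sum_hist_succ, ← ih]
    refine Finset.sum_congr rfl fun h _ => ?_
    have key : ∀ j : Fin n, ∑ r : Bool, histP n alg Δ a ((j, r) :: hist h) =
        histP n alg Δ a (hist h) * alg (hist h) j := fun j => by
      simp only [histP, Fintype.sum_bool]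
      rw [← mul_add, rewP_add, mul_one]
    rw [Fintype.sum_prod_type, Finset.sum_congr rfl fun j _ => key j, ← Finset.mul_sum,
      (halg _).2, mul_one]

lemma mutualInfo_le_log (hn : 0 < n) {alg : List (Fin n × Bool) → Fin n → ℝ}
    (halg : IsAlg n alg) {Δ : ℝ} (h0 : 0 < Δ) (h1 : Δ < 1) (t : ℕ) :
    mutualInfo n t alg Δ ≤ Real.log n := by
  have hn' : (0 : ℝ) < n := by exact_mod_cast hn
  have hterm : ∀ (a : Fin n) (l : List (Fin n × Bool)),
      ((n : ℝ))⁻¹ * histP n alg Δ a l *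
        Real.log (histP n alg Δ a l / (((n : ℝ))⁻¹ * ∑ b : Fin n, histP n alg Δ b l)) ≤
      ((n : ℝ))⁻¹ * histP n alg Δ a l * Real.log n := by
    intro a l
    have hnn := fun b => histP_nonneg halg h0 h1 b l
    rcases (hnn a).eq_or_lt with h | h
    · simp [← h]
    have hle : histP n alg Δ a l ≤ ∑ b : Fin n, histP n alg Δ b l :=
      Finset.single_le_sum (fun b _ => hnn b) (Finset.mem_univ a)
    have hZ : 0 < ∑ b : Fin n, histP n alg Δ b l := h.trans_le hle
    refine mul_le_mul_of_nonneg_left (Real.log_le_log (by positivity) ?_) (by positivity)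
    rw [div_le_iff₀ (by positivity), ← mul_assoc, mul_inv_cancel₀ hn'.ne', one_mul]
    exact hle
  calc mutualInfo n t alg Δ
      ≤ ∑ a : Fin n, ∑ h : Fin t → Fin n × Bool,
          ((n : ℝ))⁻¹ * histP n alg Δ a (hist h) * Real.log n :=
        Finset.sum_le_sum fun a _ => Finset.sum_le_sum fun h _ => hterm a (hist h)
    _ = Real.log n := by
        simp_rw [← Finset.sum_mul, ← Finset.mul_sum, sum_histP halg]
        simp [hn'.ne']

lemma mutualInfo_le_IStar (hn : 0 < n) {alg : List (Fin n × Bool) → Fin n → ℝ}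
    (halg : IsAlg n alg) {Δ : ℝ} (h0 : 0 < Δ) (h1 : Δ < 1) (t : ℕ) :
    mutualInfo n t alg Δ ≤ IStar n t Δ := by
  refine le_csSup ⟨Real.log n, ?_⟩ ⟨alg, halg, rfl⟩
  rintro x ⟨alg', halg', rfl⟩
  exact mutualInfo_le_log hn halg' h0 h1 t

/-! ### Deterministic algorithms -/

/-- The algorithm that pulls arm `π l` after history `l`. -/
def detAlg (π : List (Fin n × Bool) → Fin n) : List (Fin n × Bool) → Fin n → ℝ :=
  fun l a => if a = π l then 1 else 0

lemma isAlg_detAlg (π : List (Fin n × Bool) → Fin n) : IsAlg n (detAlg π) := by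
  refine fun l => ⟨fun a => ?_, ?_⟩
  · unfold detAlg; split_ifs <;> norm_num
  · simp [detAlg]

/-- Histories in which every pull follows the policy `π`. -/
def Reach (π : List (Fin n × Bool) → Fin n) : List (Fin n × Bool) → Prop
  | [] => True
  | (a, _) :: l => a = π l ∧ Reach π l

lemma histP_eq_zero {π : List (Fin n × Bool) → Fin n} (Δ : ℝ) (a : Fin n)
    {l : List (Fin n × Bool)} (h : ¬ Reach π l) : histP n (detAlg π) Δ a l = 0 := by
  induction l with
  | nil => exact absurd trivial h
  | cons x l ih =>
    obtain ⟨j, r⟩ := x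
    simp only [Reach, not_and_or] at h
    rcases h with h | h
    · simp [histP, detAlg, h]
    · simp [histP, ih h]

lemma histP_cons (π : List (Fin n × Bool) → Fin n) (Δ : ℝ) (a : Fin n)
    (l : List (Fin n × Bool)) (r : Bool) :
    histP n (detAlg π) Δ a ((π l, r) :: l) =
      histP n (detAlg π) Δ a l * rewP n Δ a (π l) r := by
  simp [histP, detAlg]

lemma histP_pos {π : List (Fin n × Bool) → Fin n} {Δ : ℝ} (h0 : 0 < Δ) (h1 : Δ < 1)
    (a : Fin n) {l : List (Fin n × Bool)} (h : Reach π l) :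
    0 < histP n (detAlg π) Δ a l := by
  induction l with
  | nil => simp [histP]
  | cons x l ih =>
    obtain ⟨j, r⟩ := x
    obtain ⟨rfl, hl⟩ := h
    rw [histP_cons]
    exact mul_pos (ih hl) (rewP_pos h0 h1 _ _ _)

/-- A quantity that does not decrease on average in one step, and is carried by the histories
following `π`, has at time `t` at least its initial value. -/
lemma le_sum_hist (π : List (Fin n × Bool) → Fin n) (G : List (Fin n × Bool) → ℝ)
    (hstep : ∀ l, Reach π l → G l ≤ G ((π l, true) :: l) + G ((π l, false) :: l))
    (hzero : ∀ l, ¬ Reach π l → G l = 0) (t : ℕ) :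
    G [] ≤ ∑ h : Fin t → Fin n × Bool, G (hist h) := by
  induction t with
  | zero => rw [sum_hist_zero]
  | succ t ih =>
    rw [sum_hist_succ]
    refine ih.trans (Finset.sum_le_sum fun h _ => ?_)
    rw [Fintype.sum_prod_type, Finset.sum_eq_single (π (hist h))]
    · rw [Fintype.sum_bool]
      by_cases hr : Reach π (hist h)
      · exact hstep _ hr
      · rw [hzero _ hr, hzero ((_, true) :: _) fun h' => hr h'.2,
          hzero ((_, false) :: _) fun h' => hr h'.2, add_zero]
    · intro j _ hj
      exact Finset.sum_eq_zero fun r _ => hzero ((j, r) :: hist h) fun h' => hj h'.1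
    · exact fun h' => absurd (Finset.mem_univ _) h'

/-! ### One-step information gain -/

lemma mul_log_div_ge {x y : ℝ} (hx : 0 < x) (hx1 : x ≤ 1) (hy : 0 < y) (hy1 : y ≤ 1) :
    x - y + (x - y) ^ 2 / 4 ≤ x * Real.log (x / y) := by
  obtain ⟨u, hu, rfl⟩ : ∃ u, 0 < u ∧ x = u ^ 2 :=
    ⟨√x, Real.sqrt_pos.2 hx, (Real.sq_sqrt hx.le).symm⟩
  obtain ⟨v, hv, rfl⟩ : ∃ v, 0 < v ∧ y = v ^ 2 :=
    ⟨√y, Real.sqrt_pos.2 hy, (Real.sq_sqrt hy.le).symm⟩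
  have hu1 : u ≤ 1 := by nlinarith
  have hv1 : v ≤ 1 := by nlinarith
  have hlog : 1 - v / u ≤ Real.log (u / v) := by
    have := Real.one_sub_inv_le_log_of_pos (div_pos hu hv)
    rwa [inv_div] at this
  have h2 : Real.log (u ^ 2 / v ^ 2) = 2 * Real.log (u / v) := by
    rw [← div_pow, Real.log_pow]; norm_num
  have h3 : u ^ 2 * (2 * (1 - v / u)) ≤ u ^ 2 * Real.log (u ^ 2 / v ^ 2) := by
    rw [h2]; gcongr
  have h4 : u ^ 2 * (2 * (1 - v / u)) = 2 * u ^ 2 - 2 * u * v := by field_simp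
  have h5 : (u + v) ^ 2 ≤ 4 := by nlinarith
  nlinarith [mul_le_mul_of_nonneg_left h5 (sq_nonneg (u - v))]

/-- The contribution of a history to the mutual information. -/
def infoTerm (n : ℕ) (P : Fin n → ℝ) : ℝ :=
  ∑ a : Fin n, ((n : ℝ))⁻¹ * P a * Real.log (P a / (((n : ℝ))⁻¹ * ∑ b : Fin n, P b))

lemma infoTerm_step (hn : 0 < n) {Δ : ℝ} (h0 : 0 < Δ) (h1 : Δ < 1) (P : Fin n → ℝ)
    (hP : ∀ a, 0 < P a) (j : Fin n) :
    infoTerm n P + ((n : ℝ))⁻¹ * P j * (Δ ^ 2 / 2 * ((∑ b, P b - P j) / ∑ b, P b) ^ 2) ≤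
      infoTerm n (fun a => P a * rewP n Δ a j true) +
        infoTerm n (fun a => P a * rewP n Δ a j false) := by
  have hn' : (0 : ℝ) < n := by exact_mod_cast hn
  have hZ : 0 < ∑ b, P b := Finset.sum_pos (fun b _ => hP b) ⟨j, Finset.mem_univ _⟩
  set Z := ∑ b, P b with hZdef
  set y : Bool → ℝ := fun r => (∑ b, P b * rewP n Δ b j r) / Z with hy
  have hnum : ∀ r, 0 < ∑ b, P b * rewP n Δ b j r := fun r =>
    Finset.sum_pos (fun b _ => mul_pos (hP b) (rewP_pos h0 h1 _ _ _)) ⟨j, Finset.mem_univ _⟩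
  have hypos : ∀ r, 0 < y r := fun r => div_pos (hnum r) hZ
  have hyadd : y true + y false = 1 := by
    simp only [hy]
    rw [← add_div, ← Finset.sum_add_distrib]
    simp_rw [← mul_add, rewP_add, mul_one]
    exact div_self hZ.ne'
  have hyone : ∀ r, y r ≤ 1 := by
    intro r
    have := hypos true
    have := hypos false
    cases r <;> linarith
  have hytrue : y true = (1 - Δ) / 2 + Δ * (P j / Z) := by
    have : ∑ b, P b * rewP n Δ b j true = (1 - Δ) / 2 * Z + Δ * P j := by
      have h : ∀ b, P b * rewP n Δ b j true =
          (1 - Δ) / 2 * P b + if j = b then Δ * P b else 0 := by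
        intro b; rw [rewP_true]; split_ifs <;> ring
      simp_rw [h]
      rw [Finset.sum_add_distrib, ← Finset.mul_sum, Finset.sum_ite_eq]
      simp [hZdef]
    simp only [hy]
    rw [this]
    field_simp
  have hterm : ∀ (a : Fin n) (r : Bool),
      ((n : ℝ))⁻¹ * P a * (rewP n Δ a j r * Real.log (P a / (((n : ℝ))⁻¹ * Z)) +
        (rewP n Δ a j r - y r + (rewP n Δ a j r - y r) ^ 2 / 4)) ≤
      ((n : ℝ))⁻¹ * (P a * rewP n Δ a j r) * Real.log (P a * rewP n Δ a j r /
        (((n : ℝ))⁻¹ * ∑ b, P b * rewP n Δ b j r)) := by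
    intro a r
    have hx := rewP_pos h0 h1 a j r
    have hPa := hP a
    have hsplit : P a * rewP n Δ a j r / (((n : ℝ))⁻¹ * ∑ b, P b * rewP n Δ b j r) =
        P a / (((n : ℝ))⁻¹ * Z) * (rewP n Δ a j r / y r) := by
      have := hnum r
      simp only [hy]
      field_simp
    have hyr := hypos r
    rw [hsplit, Real.log_mul (by positivity) (by positivity)]
    have := mul_log_div_ge hx (rewP_le_one h0 h1 a j r) (hypos r) (hyone r)
    calc _ ≤ ((n : ℝ))⁻¹ * P a * (rewP n Δ a j r * Real.log (P a / (((n : ℝ))⁻¹ * Z)) +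
          rewP n Δ a j r * Real.log (rewP n Δ a j r / y r)) := by gcongr
      _ = _ := by ring
  have hsum : ∀ a, ((n : ℝ))⁻¹ * P a * Real.log (P a / (((n : ℝ))⁻¹ * Z)) +
      ((n : ℝ))⁻¹ * P a * ((rewP n Δ a j true - y true) ^ 2 / 2) ≤
      ((n : ℝ))⁻¹ * (P a * rewP n Δ a j true) * Real.log (P a * rewP n Δ a j true /
        (((n : ℝ))⁻¹ * ∑ b, P b * rewP n Δ b j true)) +
      ((n : ℝ))⁻¹ * (P a * rewP n Δ a j false) * Real.log (P a * rewP n Δ a j false /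
        (((n : ℝ))⁻¹ * ∑ b, P b * rewP n Δ b j false)) := by
    intro a
    refine le_trans (le_of_eq ?_) (add_le_add (hterm a true) (hterm a false))
    have e1 : rewP n Δ a j false = 1 - rewP n Δ a j true := by
      linarith [rewP_add Δ a j]
    have e2 : y false = 1 - y true := by linarith
    rw [e1, e2]
    ring
  have hj : ((n : ℝ))⁻¹ * P j * (Δ ^ 2 / 2 * ((Z - P j) / Z) ^ 2) ≤
      ∑ a, ((n : ℝ))⁻¹ * P a * ((rewP n Δ a j true - y true) ^ 2 / 2) := by
    refine le_trans (le_of_eq ?_) (Finset.single_le_sum (f := fun a =>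
      ((n : ℝ))⁻¹ * P a * ((rewP n Δ a j true - y true) ^ 2 / 2)) (fun a _ => ?_)
      (Finset.mem_univ j))
    · rw [hytrue, rewP_true, if_pos rfl]
      field_simp
      ring
    · have := hP a
      positivity
  unfold infoTerm
  rw [← Finset.sum_add_distrib]
  refine le_trans ?_ (Finset.sum_le_sum fun a _ => hsum a)
  rw [Finset.sum_add_distrib]
  gcongr

lemma mutualInfo_eq (n t : ℕ) (alg : List (Fin n × Bool) → Fin n → ℝ) (Δ : ℝ) :
    mutualInfo n t alg Δ =
      ∑ h : Fin t → Fin n × Bool, infoTerm n (fun a => histP n alg Δ a (hist h)) := by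
  rw [mutualInfo, Finset.sum_comm]
  rfl

/-! ### Scores, pull counts and the threshold policy -/

/-- Number of successes minus number of failures of arm `b`. -/
def score (b : Fin n) : List (Fin n × Bool) → ℤ
  | [] => 0
  | (j, r) :: l => score b l + if j = b then (if r then 1 else -1) else 0

/-- Number of pulls of arm `a`. -/
def pulls (a : Fin n) (l : List (Fin n × Bool)) : ℕ := l.countP fun x => x.1 = a

/-- Number of pulls of arms of index smaller than `a`. -/
def earlier (a : Fin n) (l : List (Fin n × Bool)) : ℕ := l.countP fun x => x.1 < a

lemma score_cons_of_ne {b j : Fin n} (h : j ≠ b) (r : Bool) (l : List (Fin n × Bool)) :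
    score b ((j, r) :: l) = score b l := by
  simp [score, h]

lemma pulls_cons (a j : Fin n) (r : Bool) (l : List (Fin n × Bool)) :
    pulls a ((j, r) :: l) = pulls a l + if j = a then 1 else 0 := by
  simp [pulls, List.countP_cons]

lemma earlier_cons (a j : Fin n) (r : Bool) (l : List (Fin n × Bool)) :
    earlier a ((j, r) :: l) = earlier a l + if j < a then 1 else 0 := by
  simp [earlier, List.countP_cons]

/-- Pull the first arm whose score is above `-K`, and arm `d` if there is none before it. -/
def policy (K : ℕ) (d : Fin n) (l : List (Fin n × Bool)) : Fin n :=
  (Finset.univ.filter fun j => -(K : ℤ) < score j l ∨ j = d).min' ⟨d, by simp⟩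

lemma policy_spec (K : ℕ) (d : Fin n) (l : List (Fin n × Bool)) :
    -(K : ℤ) < score (policy K d l) l ∨ policy K d l = d := by
  have := Finset.min'_mem (Finset.univ.filter fun j => -(K : ℤ) < score j l ∨ j = d)
    ⟨d, by simp⟩
  simpa [policy] using this

lemma policy_le {K : ℕ} {d j : Fin n} {l : List (Fin n × Bool)} (h : -(K : ℤ) < score j l) :
    policy K d l ≤ j :=
  Finset.min'_le _ _ (by simp [h])

lemma neg_le_score {K : ℕ} {d b : Fin n} (hb : b ≠ d) {l : List (Fin n × Bool)}
    (h : Reach (policy K d) l) : -(K : ℤ) ≤ score b l := by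
  induction l with
  | nil => simp [score]
  | cons x l ih =>
    obtain ⟨j, r⟩ := x
    obtain ⟨rfl, hl⟩ := h
    have hS := ih hl
    by_cases hj : policy K d l = b
    · have hspec := policy_spec K d l
      rw [hj] at hspec ⊢
      have : -(K : ℤ) < score b l := hspec.resolve_right hb
      simp only [score, if_true]
      split_ifs <;> omega
    · rwa [score_cons_of_ne hj]

lemma reach_active {K : ℕ} {d a : Fin n} (ha : a ≠ d) {l : List (Fin n × Bool)}
    (h : Reach (policy K d) l) (hS : -(K : ℤ) < score a l) :
    pulls a l + earlier a l = l.length ∧ ∀ b, a < b → score b l = 0 := by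
  induction l with
  | nil => simp [pulls, earlier, score]
  | cons x l ih =>
    obtain ⟨j, r⟩ := x
    obtain ⟨rfl, hl⟩ := h
    have hS' : -(K : ℤ) < score a l := by
      by_cases hj : policy K d l = a
      · have hspec := policy_spec K d l
        rw [hj] at hspec
        exact hspec.resolve_right ha
      · rwa [score_cons_of_ne hj] at hS
    obtain ⟨h1, h2⟩ := ih hl hS'
    have hle : policy K d l ≤ a := policy_le hS'
    refine ⟨?_, fun b hb => ?_⟩
    · rw [pulls_cons, earlier_cons, List.length_cons]
      rcases hle.eq_or_lt with h | h
      · simp only [h, if_true, lt_irrefl, if_false]; omega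
      · simp only [h, h.ne, if_true, if_false]; omega
    · rw [score_cons_of_ne (hle.trans_lt hb).ne, h2 b hb]

/-! ### Likelihood ratios and martingales -/

/-- Likelihood ratio of a success. -/
def lr (Δ : ℝ) : ℝ := (1 + Δ) / (1 - Δ)

/-- Mean of the likelihood ratio of one pull of the best arm. -/
def lrMean (Δ : ℝ) : ℝ := (1 + 3 * Δ ^ 2) / (1 - Δ ^ 2)

lemma lr_pos {Δ : ℝ} (h0 : 0 < Δ) (h1 : Δ < 1) : 0 < lr Δ :=
  div_pos (by linarith) (by linarith)

lemma lrMean_pos {Δ : ℝ} (h0 : 0 < Δ) (h1 : Δ < 1) : 0 < lrMean Δ :=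
  div_pos (by positivity) (by nlinarith)

lemma score_cons_self (a : Fin n) (r : Bool) (l : List (Fin n × Bool)) :
    score a ((a, r) :: l) = score a l + if r then 1 else -1 := by
  simp [score]

lemma histP_ratio {π : List (Fin n × Bool) → Fin n} {Δ : ℝ} (h0 : 0 < Δ) (h1 : Δ < 1)
    {l : List (Fin n × Bool)} (h : Reach π l) :
    ∃ c : ℝ, 0 < c ∧ ∀ a, histP n (detAlg π) Δ a l = c * lr Δ ^ score a l := by
  induction l with
  | nil => exact ⟨1, one_pos, fun a => by simp [histP, score]⟩
  | cons x l ih =>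
    obtain ⟨j, r⟩ := x
    obtain ⟨rfl, hl⟩ := h
    obtain ⟨c, hc, hca⟩ := ih hl
    have hd : (0 : ℝ) < 1 - Δ := by linarith
    have hd' : (0 : ℝ) < 1 + Δ := by linarith
    refine ⟨c * (if r then (1 - Δ) / 2 else (1 + Δ) / 2), ?_, fun a => ?_⟩
    · split_ifs <;> positivity
    rw [histP_cons, hca]
    by_cases hj : π l = a
    · subst hj
      rw [score_cons_self, zpow_add₀ (lr_pos h0 h1).ne']
      cases r
      · simp only [rewP_false, if_true, Bool.false_eq_true, if_false, zpow_neg, zpow_one, lr]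
        field_simp
      · simp only [rewP_true, if_true, zpow_one, lr]
        field_simp
    · rw [score_cons_of_ne hj]
      cases r
      · simp only [rewP_false, hj, if_false, Bool.false_eq_true]; ring
      · simp only [rewP_true, hj, if_false, if_true]; ring

lemma lr_inv_step {Δ : ℝ} (h0 : 0 < Δ) (h1 : Δ < 1) (a j : Fin n)
    (l : List (Fin n × Bool)) :
    rewP n Δ a j true * lr Δ ^ (-score a ((j, true) :: l)) +
      rewP n Δ a j false * lr Δ ^ (-score a ((j, false) :: l)) = lr Δ ^ (-score a l) := by
  have hd : (0 : ℝ) < 1 - Δ := by linarith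
  have hd' : (0 : ℝ) < 1 + Δ := by linarith
  by_cases hj : j = a
  · subst hj
    simp only [score_cons_self, rewP_true, rewP_false, if_true, Bool.false_eq_true, if_false,
      neg_add, zpow_add₀ (lr_pos h0 h1).ne', neg_neg, zpow_one, zpow_neg _ 1]
    generalize lr Δ ^ (-score j l) = u
    unfold lr
    field_simp
    ring
  · rw [score_cons_of_ne hj, score_cons_of_ne hj, ← add_mul, rewP_add, one_mul]

/-- The normalized likelihood ratio of arm `a`, a martingale when `a` is the best arm. -/
def normLR (Δ : ℝ) (a : Fin n) (l : List (Fin n × Bool)) : ℝ :=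
  lr Δ ^ score a l / lrMean Δ ^ pulls a l

lemma normLR_pos {Δ : ℝ} (h0 : 0 < Δ) (h1 : Δ < 1) (a : Fin n) (l : List (Fin n × Bool)) :
    0 < normLR Δ a l :=
  div_pos (zpow_pos (lr_pos h0 h1) _) (pow_pos (lrMean_pos h0 h1) _)

lemma normLR_cons_of_ne (Δ : ℝ) {a j : Fin n} (hj : j ≠ a) (r : Bool)
    (l : List (Fin n × Bool)) : normLR Δ a ((j, r) :: l) = normLR Δ a l := by
  simp [normLR, score_cons_of_ne hj, pulls_cons, hj]

lemma normLR_step {Δ : ℝ} (h0 : 0 < Δ) (h1 : Δ < 1) (a j : Fin n)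
    (l : List (Fin n × Bool)) :
    rewP n Δ a j true * normLR Δ a ((j, true) :: l) +
      rewP n Δ a j false * normLR Δ a ((j, false) :: l) = normLR Δ a l := by
  have hd : (0 : ℝ) < 1 - Δ := by linarith
  have hd' : (0 : ℝ) < 1 + Δ := by linarith
  have hd2 : (1 - Δ ^ 2 : ℝ) ≠ 0 := by nlinarith
  by_cases hj : j = a
  · subst hj
    have hq := (lrMean_pos h0 h1).ne'
    have key : (1 + Δ) / 2 * lr Δ + (1 - Δ) / 2 * (lr Δ)⁻¹ = lrMean Δ := by
      have e : (1 - Δ ^ 2 : ℝ) = (1 - Δ) * (1 + Δ) := by ring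
      unfold lr lrMean
      rw [e]
      field_simp
      ring
    simp only [normLR, pulls_cons, score_cons_self, rewP_true, rewP_false, if_true,
      Bool.false_eq_true, if_false, zpow_add₀ (lr_pos h0 h1).ne', zpow_one, zpow_neg _ 1, pow_succ]
    generalize lr Δ ^ score j l = u
    have hp : lrMean Δ ^ pulls j l ≠ 0 := pow_ne_zero _ hq
    generalize lrMean Δ ^ pulls j l = v at hp ⊢
    calc _ = u * ((1 + Δ) / 2 * lr Δ + (1 - Δ) / 2 * (lr Δ)⁻¹) / (v * lrMean Δ) := by ring
      _ = u / v := by rw [key]; field_simp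
  · rw [normLR_cons_of_ne _ hj, normLR_cons_of_ne _ hj, ← add_mul, rewP_add, one_mul]

/-- A martingale that dominates `Δ` times the number of pulls of the arms before `a`. -/
def delay (Δ : ℝ) (K : ℕ) (a : Fin n) (l : List (Fin n × Bool)) : ℝ :=
  Δ * earlier a l + ∑ b ∈ Finset.Iio a, ((score b l : ℝ) + K)

lemma delay_nil (Δ : ℝ) (K : ℕ) (a : Fin n) : delay Δ K a [] = a * K := by
  simp [delay, earlier, score]

lemma delay_cons (Δ : ℝ) (K : ℕ) (a j : Fin n) (r : Bool) (l : List (Fin n × Bool)) :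
    delay Δ K a ((j, r) :: l) =
      delay Δ K a l + if j < a then Δ + (if r then 1 else -1) else 0 := by
  have h : ∀ b, ((score b ((j, r) :: l) : ℤ) : ℝ) + K =
      (score b l + K) + if j = b then (if r then (1 : ℝ) else -1) else 0 := by
    intro b
    simp only [score]
    push_cast
    ring
  simp only [delay, earlier_cons]
  simp_rw [h]
  rw [Finset.sum_add_distrib, Finset.sum_ite_eq]
  simp only [Finset.mem_Iio]
  split_ifs <;> push_cast <;> ring

lemma delay_step (Δ : ℝ) (K : ℕ) (a j : Fin n) (l : List (Fin n × Bool)) :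
    rewP n Δ a j true * delay Δ K a ((j, true) :: l) +
      rewP n Δ a j false * delay Δ K a ((j, false) :: l) = delay Δ K a l := by
  simp only [delay_cons, rewP_true, rewP_false, if_true, Bool.false_eq_true, if_false]
  by_cases hj : j < a
  · simp only [hj, hj.ne, if_true, if_false]; ring
  · simp only [hj, if_false]; split_ifs <;> ring

lemma earlier_le_delay {Δ : ℝ} {K : ℕ} {d a : Fin n} (hd : ∀ j, j ≤ d)
    {l : List (Fin n × Bool)} (h : Reach (policy K d) l) :
    Δ * earlier a l ≤ delay Δ K a l := by
  refine le_add_of_nonneg_right (Finset.sum_nonneg fun b hb => ?_)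
  have hb' : b ≠ d := ((Finset.mem_Iio.1 hb).trans_le (hd a)).ne
  have : -(K : ℝ) ≤ score b l := by exact_mod_cast neg_le_score hb' h
  linarith

/-! ### Information collected by the threshold policy -/

/-- Truncated pull count of arm `a`, corrected for the histories in which `a` is already
likely. -/
def gain (Δ τ : ℝ) (a : Fin n) (l : List (Fin n × Bool)) : ℝ :=
  min (pulls a l : ℝ) τ * (1 - 3 / 29 * normLR Δ a l)

lemma gain_cons_of_ne (Δ τ : ℝ) {a j : Fin n} (hj : j ≠ a) (r : Bool)
    (l : List (Fin n × Bool)) : gain Δ τ a ((j, r) :: l) = gain Δ τ a l := by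
  simp [gain, normLR_cons_of_ne _ hj, pulls_cons, hj]

lemma gain_step_self {Δ : ℝ} (h0 : 0 < Δ) (h1 : Δ < 1) (τ : ℝ) (a : Fin n)
    (l : List (Fin n × Bool)) :
    rewP n Δ a a true * gain Δ τ a ((a, true) :: l) +
      rewP n Δ a a false * gain Δ τ a ((a, false) :: l) =
    min ((pulls a l : ℝ) + 1) τ * (1 - 3 / 29 * normLR Δ a l) := by
  have hM := normLR_step h0 h1 a a l
  have hr := rewP_add Δ a a
  simp only [gain, pulls_cons, if_true]
  push_cast
  rw [← hM]
  linear_combination (min ((pulls a l : ℝ) + 1) τ) * hr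

/-- Pulling an active arm of small index yields enough information to pay for its gain. -/
lemma gain_increment_le (hn : 2 ≤ n) {Δ : ℝ} (h0 : 0 < Δ) (h1 : Δ < 1) {K : ℕ} {d : Fin n}
    {τ : ℝ} (hτ : ∀ N : ℕ, (N : ℝ) < τ → lrMean Δ ^ N ≤ n) {l : List (Fin n × Bool)}
    (hl : Reach (policy K d) l) {a : Fin n} (had : a ≠ d) (ha : (a : ℝ) ≤ n / 6)
    (hS : -(K : ℤ) < score a l) :
    29 / 4000 * ((min ((pulls a l : ℝ) + 1) τ - min (pulls a l : ℝ) τ) *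
      (1 - 3 / 29 * normLR Δ a l)) ≤
    ((∑ b, histP n (detAlg (policy K d)) Δ b l - histP n (detAlg (policy K d)) Δ a l) /
      ∑ b, histP n (detAlg (policy K d)) Δ b l) ^ 2 := by
  rcases le_or_gt τ (pulls a l : ℝ) with hN | hN
  · rw [min_eq_right hN, min_eq_right (by linarith), sub_self, zero_mul, mul_zero]
    positivity
  have hn' : (2 : ℝ) ≤ n := by exact_mod_cast hn
  set m := min ((pulls a l : ℝ) + 1) τ - min (pulls a l : ℝ) τ with hm
  have hm0 : 0 ≤ m := sub_nonneg.2 (min_le_min_right _ (by linarith))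
  have hm1 : m ≤ 1 := by
    rw [hm, min_eq_left hN.le]
    linarith [min_le_left ((pulls a l : ℝ) + 1) τ]
  rcases le_or_gt (1 - 3 / 29 * normLR Δ a l) 0 with hM | hM
  · have : m * (1 - 3 / 29 * normLR Δ a l) ≤ 0 := mul_nonpos_of_nonneg_of_nonpos hm0 hM
    refine le_trans ?_ (sq_nonneg _)
    linarith
  have hmM : m * (1 - 3 / 29 * normLR Δ a l) ≤ 1 - 3 / 29 * normLR Δ a l :=
    mul_le_of_le_one_left hM.le hm1
  obtain ⟨c, hc, hP⟩ := histP_ratio (Δ := Δ) h0 h1 hl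
  set Z := ∑ b, histP n (detAlg (policy K d)) Δ b l with hZ
  set P := histP n (detAlg (policy K d)) Δ a l with hPdef
  set u := lr Δ ^ score a l with hu
  have hu0 : 0 < u := zpow_pos (lr_pos h0 h1) _
  have hPa : P = c * u := hP a
  have hrest : c * (n / 3) ≤ Z - P := by
    have hzero := (reach_active had hl hS).2
    have hsub : ∑ b ∈ Finset.Ioi a, histP n (detAlg (policy K d)) Δ b l + P ≤ Z := by
      rw [hPdef, ← Finset.sum_singleton (fun b => histP n (detAlg (policy K d)) Δ b l) a,
        ← Finset.sum_union (by simp)]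
      exact Finset.sum_le_sum_of_subset_of_nonneg (Finset.subset_univ _)
        fun b _ _ => (histP_pos h0 h1 b hl).le
    have hIoi : ∑ b ∈ Finset.Ioi a, histP n (detAlg (policy K d)) Δ b l =
        c * ((n : ℝ) - 1 - a) := by
      rw [Finset.sum_congr rfl (g := fun _ => c), Finset.sum_const, Fin.card_Ioi, nsmul_eq_mul,
        mul_comm]
      · have := a.2
        rw [Nat.sub_sub, Nat.cast_sub (by omega)]
        push_cast
        ring
      · intro b hb
        rw [hP, hzero b (Finset.mem_Ioi.1 hb), zpow_zero, mul_one]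
    have : c * (n / 3) ≤ c * ((n : ℝ) - 1 - a) :=
      mul_le_mul_of_nonneg_left (by linarith) hc.le
    linarith
  have hP0 : 0 < P := histP_pos h0 h1 a hl
  have hrest0 : 0 < Z - P := lt_of_lt_of_le (by positivity) hrest
  have hZ0 : 0 < Z := by linarith
  set Y := 3 * u / n with hY
  have hY0 : 0 < Y := by positivity
  have hPY : P ≤ Y * (Z - P) := by
    calc P = Y * (c * (n / 3)) := by rw [hPa, hY]; field_simp
      _ ≤ _ := by gcongr
  have hfrac : 1 / (1 + Y) ≤ (Z - P) / Z := by
    rw [div_le_div_iff₀ (by positivity) hZ0]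
    linarith
  have hYM : Y ≤ 3 * normLR Δ a l := by
    have hq : 0 < lrMean Δ ^ pulls a l := pow_pos (lrMean_pos h0 h1) _
    have : u / n ≤ u / lrMean Δ ^ pulls a l :=
      div_le_div_of_nonneg_left hu0.le hq (hτ _ hN)
    calc Y = 3 * (u / n) := by rw [hY]; ring
      _ ≤ _ := by unfold normLR; gcongr
  have htangent : 29 / 4000 * (1 - Y / 29) ≤ (1 / (1 + Y)) ^ 2 := by
    rw [div_pow, one_pow, le_div_iff₀ (by positivity)]
    nlinarith [mul_nonneg (by linarith : (0 : ℝ) ≤ Y + 41) (sq_nonneg (Y - 19))]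
  calc _ ≤ 29 / 4000 * (1 - Y / 29) := by linarith
    _ ≤ (1 / (1 + Y)) ^ 2 := htangent
    _ ≤ _ := by gcongr

lemma sum_gain_le_mutualInfo (hn : 2 ≤ n) {Δ : ℝ} (h0 : 0 < Δ) (h1 : Δ < 1) (K : ℕ)
    {d : Fin n} {τ : ℝ} (hτ0 : 0 ≤ τ)
    (hτ : ∀ N : ℕ, (N : ℝ) < τ → lrMean Δ ^ N ≤ n) (A : Finset (Fin n))
    (hA : ∀ a ∈ A, a ≠ d ∧ (a : ℝ) ≤ n / 6) (t : ℕ) :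
    29 * Δ ^ 2 / (8000 * n) * ∑ a ∈ A, ∑ h : Fin t → Fin n × Bool,
      histP n (detAlg (policy K d)) Δ a (hist h) * gain Δ τ a (hist h) ≤
    mutualInfo n t (detAlg (policy K d)) Δ := by
  have hn' : (0 : ℝ) < n := by exact_mod_cast (by omega : 0 < n)
  set π := policy K d with hπ
  set C := 29 * Δ ^ 2 / (8000 * (n : ℝ)) with hC
  have hC0 : 0 < C := by positivity
  set P : Fin n → List (Fin n × Bool) → ℝ := fun a l => histP n (detAlg π) Δ a l with hP
  have key := le_sum_hist π
    (fun l => infoTerm n (fun a => P a l) - C * ∑ a ∈ A, P a l * gain Δ τ a l) ?_ ?_ t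
  · rw [Finset.sum_sub_distrib, ← Finset.mul_sum, ← mutualInfo_eq, Finset.sum_comm] at key
    have hnil : infoTerm n (fun a => P a []) - C * ∑ a ∈ A, P a [] * gain Δ τ a [] = 0 := by
      simp [infoTerm, P, histP, gain, pulls, hn'.ne', hτ0]
    simp only [hnil] at key
    linarith
  · intro l hl
    have hPpos : ∀ a, 0 < P a l := fun a => histP_pos h0 h1 a hl
    have hinfo := infoTerm_step (by omega) h0 h1 (fun a => P a l) hPpos (π l)
    have hcons : ∀ a r, P a ((π l, r) :: l) = P a l * rewP n Δ a (π l) r := fun a r =>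
      histP_cons π Δ a l r
    have hgain : C * ∑ a ∈ A, (P a l * rewP n Δ a (π l) true * gain Δ τ a ((π l, true) :: l) +
        P a l * rewP n Δ a (π l) false * gain Δ τ a ((π l, false) :: l) -
        P a l * gain Δ τ a l) ≤
        ((n : ℝ))⁻¹ * P (π l) l *
          (Δ ^ 2 / 2 * ((∑ b, P b l - P (π l) l) / ∑ b, P b l) ^ 2) := by
      have hne : ∀ a, a ≠ π l →
          P a l * rewP n Δ a (π l) true * gain Δ τ a ((π l, true) :: l) +
          P a l * rewP n Δ a (π l) false * gain Δ τ a ((π l, false) :: l) -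
          P a l * gain Δ τ a l = 0 := by
        intro a ha
        rw [gain_cons_of_ne _ _ ha.symm, gain_cons_of_ne _ _ ha.symm]
        linear_combination P a l * gain Δ τ a l * rewP_add Δ a (π l)
      have hPj := hPpos (π l)
      by_cases hj : π l ∈ A
      · rw [Finset.sum_eq_single_of_mem _ hj fun a _ ha => hne a ha]
        obtain ⟨hjd, hj6⟩ := hA _ hj
        have hS := (policy_spec K d l).resolve_right hjd
        have hinc := gain_increment_le hn h0 h1 hτ hl hjd hj6 hS
        have hstep := gain_step_self h0 h1 τ (π l) l
        have hself : gain Δ τ (π l) l =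
            min (pulls (π l) l : ℝ) τ * (1 - 3 / 29 * normLR Δ (π l) l) := rfl
        calc _ = ((n : ℝ))⁻¹ * P (π l) l * (Δ ^ 2 / 2 * (29 / 4000 *
              ((min ((pulls (π l) l : ℝ) + 1) τ - min (pulls (π l) l : ℝ) τ) *
                (1 - 3 / 29 * normLR Δ (π l) l)))) := by
              rw [sub_mul, ← hstep, ← hself, hC, mul_assoc (P _ _), mul_assoc (P _ _)]
              field_simp
              ring
          _ ≤ _ := by gcongr
      · rw [Finset.sum_eq_zero fun a ha => hne a fun h => hj (h ▸ ha), mul_zero]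
        positivity
    rw [Finset.sum_sub_distrib, Finset.sum_add_distrib] at hgain
    simp only [hcons]
    linarith
  · intro l hl
    have : ∀ a, P a l = 0 := fun a => histP_eq_zero Δ a hl
    simp [this, infoTerm]

lemma le_sum_gain {Δ : ℝ} (h0 : 0 < Δ) (h1 : Δ < 1) {K : ℕ} (hK : 1 ≤ K * Δ) {d : Fin n}
    (hd : ∀ j, j ≤ d) {t : ℕ} (ht : 0 < t) {τ : ℝ} (hτ0 : 0 ≤ τ) (hτ : τ ≤ t / 2) {a : Fin n}
    (had : a ≠ d) (ha : (a : ℝ) * K ≤ t * Δ / 6) :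
    τ / 6 ≤ ∑ h : Fin t → Fin n × Bool,
      histP n (detAlg (policy K d)) Δ a (hist h) * gain Δ τ a (hist h) := by
  have ht' : (0 : ℝ) < t := by exact_mod_cast ht
  have hlr := lr_pos h0 h1
  have hlr2 : 1 + 2 * Δ ≤ lr Δ := by
    unfold lr
    rw [le_div_iff₀ (by linarith)]
    nlinarith
  have hlr1 : 1 ≤ lr Δ := by linarith
  have hpow : 3 ≤ lr Δ ^ K := by
    have h3 := one_add_mul_le_pow (a := 2 * Δ) (by linarith) K
    have h4 : (1 + 2 * Δ) ^ K ≤ lr Δ ^ K := pow_le_pow_left₀ (by linarith) hlr2 K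
    nlinarith
  set π := policy K d with hπ
  set P : List (Fin n × Bool) → ℝ := fun l => histP n (detAlg π) Δ a l with hP
  set v := (lr Δ ^ K)⁻¹ with hv
  have hv3 : v ≤ 1 / 3 := by
    rw [hv, one_div]
    exact inv_anti₀ (by norm_num) hpow
  have hv0 : 0 < v := by positivity
  set g : List (Fin n × Bool) → ℝ := fun l => τ * (1 - v * lr Δ ^ (-score a l) -
    2 / (t * Δ) * delay Δ K a l - 3 / 29 * normLR Δ a l) with hg
  have key := le_sum_hist π (fun l => P l * g l) ?_ ?_ t
  · have hnil : τ / 6 ≤ P [] * g [] := by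
      have hnorm : normLR Δ a [] = 1 := by simp [normLR, score, pulls]
      have hP1 : P [] = 1 := rfl
      have hs : lr Δ ^ (-score a []) = 1 := by simp [score]
      have hdel : 2 / (t * Δ) * delay Δ K a [] ≤ 1 / 3 := by
        rw [delay_nil]
        calc 2 / (t * Δ) * (a * K) ≤ 2 / (t * Δ) * (t * Δ / 6) := by gcongr
          _ = 1 / 3 := by field_simp; norm_num
      simp only [hg, hP1, hnorm, hs]
      nlinarith
    refine hnil.trans (key.trans (Finset.sum_le_sum fun h _ => ?_))
    by_cases hl : Reach π (hist h)
    swap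
    · simp [hP, histP_eq_zero Δ a hl]
    refine mul_le_mul_of_nonneg_left ?_ (histP_pos h0 h1 a hl).le
    have hlen := length_hist h
    generalize hist h = l at hl hlen
    have hM := normLR_pos h0 h1 a l
    have hT := earlier_le_delay (Δ := Δ) (a := a) hd hl
    have hTt : 2 / t * (earlier a l : ℝ) ≤ 2 / (t * Δ) * delay Δ K a l := by
      calc 2 / t * (earlier a l : ℝ) = 2 / (t * Δ) * (Δ * earlier a l) := by field_simp
        _ ≤ _ := by gcongr
    have hvs : 0 < v * lr Δ ^ (-score a l) := mul_pos hv0 (zpow_pos hlr _)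
    have hmain : τ * (1 - v * lr Δ ^ (-score a l) - 2 / t * (earlier a l : ℝ)) ≤
        min (pulls a l : ℝ) τ := by
      have hmin0 : 0 ≤ min (pulls a l : ℝ) τ := le_min (by positivity) hτ0
      have hE0 : 0 ≤ 2 / t * (earlier a l : ℝ) := by positivity
      rcases lt_or_ge (-(K : ℤ)) (score a l) with hS | hS
      · have hcount := (reach_active had hl hS).1
        rw [hlen] at hcount
        have hcount' : (pulls a l : ℝ) + earlier a l = t := by exact_mod_cast hcount
        rcases le_or_gt (earlier a l : ℝ) (t / 2) with hE | hE
        · rw [min_eq_right (by linarith)]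
          nlinarith
        · have : 1 ≤ 2 / t * (earlier a l : ℝ) := by
            rw [div_mul_eq_mul_div, le_div_iff₀ ht']
            linarith
          nlinarith
      · have : 1 ≤ v * lr Δ ^ (-score a l) := by
          have h5 : lr Δ ^ (K : ℤ) ≤ lr Δ ^ (-score a l) := zpow_le_zpow_right₀ hlr1 (by omega)
          rw [zpow_natCast] at h5
          rw [hv, inv_mul_eq_div, le_div_iff₀ (by positivity), one_mul]
          exact h5
        nlinarith
    have hminτ : min (pulls a l : ℝ) τ * (3 / 29 * normLR Δ a l) ≤
        τ * (3 / 29 * normLR Δ a l) :=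
      mul_le_mul_of_nonneg_right (min_le_right _ _) (by positivity)
    simp only [hg, gain]
    nlinarith [mul_le_mul_of_nonneg_left hTt hτ0]
  · intro l hl
    have hcons : ∀ r, P ((π l, r) :: l) = P l * rewP n Δ a (π l) r := fun r =>
      histP_cons π Δ a l r
    have e1 := lr_inv_step h0 h1 a (π l) l
    have e2 := normLR_step h0 h1 a (π l) l
    have e3 := delay_step Δ K a (π l) l
    have e4 := rewP_add Δ a (π l)
    simp only [hcons, hg]
    refine le_of_eq ?_
    linear_combination P l * τ * (v * e1 + 3 / 29 * e2 + 2 / (t * Δ) * e3 - e4)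
  · intro l hl
    simp [hP, histP_eq_zero Δ a hl]

lemma lrMean_pow_le {ε Δ τ : ℝ} (hε : 0 < ε) (h0 : 0 < Δ) (h1 : Δ ≤ 1 - ε) (hn : 0 < n)
    (hτ : τ = ε * Real.log n / (4 * Δ ^ 2)) (N : ℕ) (hN : (N : ℝ) < τ) :
    lrMean Δ ^ N ≤ n := by
  have hn' : (0 : ℝ) < n := by exact_mod_cast hn
  have hle : lrMean Δ ≤ Real.exp (4 * Δ ^ 2 / ε) := by
    have hden : ε ≤ 1 - Δ ^ 2 := by nlinarith
    have hpos : 0 < 1 - Δ ^ 2 := by linarith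
    have e : lrMean Δ = 4 * Δ ^ 2 / (1 - Δ ^ 2) + 1 := by
      unfold lrMean; field_simp; ring
    have : 4 * Δ ^ 2 / (1 - Δ ^ 2) ≤ 4 * Δ ^ 2 / ε := by gcongr
    linarith [Real.add_one_le_exp (4 * Δ ^ 2 / ε)]
  calc lrMean Δ ^ N ≤ Real.exp (4 * Δ ^ 2 / ε) ^ N :=
        pow_le_pow_left₀ (lrMean_pos h0 (by linarith)).le hle N
    _ = Real.exp (N * (4 * Δ ^ 2 / ε)) := by rw [← Real.exp_nat_mul]
    _ ≤ Real.exp (τ * (4 * Δ ^ 2 / ε)) := by gcongr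
    _ = n := by
        have : τ * (4 * Δ ^ 2 / ε) = Real.log n := by rw [hτ]; field_simp
        rw [this, Real.exp_log hn']

end Bandit

/-- Achievability for the mutual information, second linear regime: for every `ε ∈ (0,1)` there
is `c > 0` such that for all `n ≥ 2`, `Δ ∈ (0, 1-ε]` and horizons `(log n)/Δ² < t ≤ n/Δ²`,
`I*_t ≥ c t Δ² (log n) / n`. -/
theorem bandit_info_achievability_large_t :
    ∀ ε : ℝ, ε ∈ Set.Ioo (0 : ℝ) 1 → ∃ c : ℝ, 0 < c ∧
      ∀ n : ℕ, 2 ≤ n → ∀ Δ : ℝ, Δ ∈ Set.Ioc (0 : ℝ) (1 - ε) →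
        ∀ t : ℕ, Real.log n / Δ ^ 2 < (t : ℝ) → (t : ℝ) ≤ (n : ℝ) / Δ ^ 2 →
          c * t * Δ ^ 2 * Real.log n / n ≤ IStar n t Δ := by
  rintro ε ⟨hε, hε1⟩
  refine ⟨ε / 100000, by positivity, fun n hn Δ ⟨h0, hΔ⟩ t ht1 ht2 => ?_⟩
  have h1 : Δ < 1 := by linarith
  have hn2 : (2 : ℝ) ≤ n := by exact_mod_cast hn
  have hlog : 0 < Real.log n := Real.log_pos (by linarith)
  have ht' : (0 : ℝ) < t := lt_trans (by positivity) ht1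
  have ht : 0 < t := by exact_mod_cast ht'
  have hlogt : Real.log n ≤ t * Δ ^ 2 := ((div_lt_iff₀ (by positivity)).1 ht1).le
  have htn : t * Δ ^ 2 ≤ n := (le_div_iff₀ (by positivity)).1 ht2
  set K := ⌈1 / Δ⌉₊ with hKdef
  have hK1 : 1 ≤ K * Δ := (div_le_iff₀ h0).1 (Nat.le_ceil (1 / Δ))
  have hK2 : K * Δ ≤ 2 := by
    have h := Nat.ceil_lt_add_one (a := 1 / Δ) (by positivity)
    have h' : (K : ℝ) * Δ ≤ (1 / Δ + 1) * Δ := by gcongr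
    have e : (1 / Δ + 1) * Δ = 1 + Δ := by field_simp
    linarith
  have hK0 : (0 : ℝ) < K := by
    by_contra h
    nlinarith
  set τ := ε * Real.log n / (4 * Δ ^ 2) with hτdef
  have hτ0 : 0 ≤ τ := by positivity
  have hτt : τ ≤ t / 2 := by
    rw [hτdef, div_le_iff₀ (by positivity)]
    nlinarith
  set x := t * Δ / (6 * K) with hx
  have hx0 : 0 ≤ x := by positivity
  have hx6 : x ≤ n / 6 := by
    rw [hx, div_le_div_iff₀ (by positivity) (by norm_num)]
    nlinarith
  have hx12 : t * Δ ^ 2 / 12 ≤ x := by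
    rw [hx, div_le_div_iff₀ (by norm_num) (by positivity)]
    nlinarith [mul_le_mul_of_nonneg_left hK2 (by positivity : 0 ≤ t * Δ)]
  have hfloor : (⌊x⌋₊ : ℝ) ≤ x := Nat.floor_le hx0
  have hfn : ⌊x⌋₊ + 1 < n := by
    have : (⌊x⌋₊ : ℝ) < n - 1 := by linarith
    have : ((⌊x⌋₊ + 1 : ℕ) : ℝ) < n := by push_cast; linarith
    exact_mod_cast this
  set d : Fin n := ⟨n - 1, by omega⟩ with hd
  set A : Finset (Fin n) := Finset.Iic ⟨⌊x⌋₊, by omega⟩ with hA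
  have hAx : ∀ a ∈ A, a ≠ d ∧ (a : ℝ) ≤ x := by
    intro a ha
    have ha' : (a : ℕ) ≤ ⌊x⌋₊ := Fin.le_def.1 (Finset.mem_Iic.1 ha)
    refine ⟨fun h => ?_, le_trans (by exact_mod_cast ha') hfloor⟩
    have : (a : ℕ) = n - 1 := by rw [h]
    omega
  have hAcard : x ≤ A.card := by
    rw [hA, Fin.card_Iic]
    push_cast
    exact (Nat.lt_floor_add_one x).le
  have hgain : ∀ a ∈ A, τ / 6 ≤ ∑ h : Fin t → Fin n × Bool,
      histP n (Bandit.detAlg (Bandit.policy K d)) Δ a (hist h) *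
        Bandit.gain Δ τ a (hist h) := by
    intro a ha
    obtain ⟨had, hax⟩ := hAx a ha
    refine Bandit.le_sum_gain h0 h1 hK1 (fun j => Fin.le_def.2 ?_) ht hτ0 hτt had ?_
    · have := j.2
      simp only [hd]
      omega
    · calc (a : ℝ) * K ≤ x * K := by gcongr
        _ = t * Δ / 6 := by rw [hx]; field_simp
  have hinfo := Bandit.sum_gain_le_mutualInfo hn h0 h1 K (d := d) hτ0
    (Bandit.lrMean_pow_le hε h0 hΔ (by omega) hτdef) A
    (fun a ha => ⟨(hAx a ha).1, (hAx a ha).2.trans hx6⟩) t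
  have hsum : t * Δ ^ 2 / 12 * (τ / 6) ≤ ∑ a ∈ A, ∑ h : Fin t → Fin n × Bool,
      histP n (Bandit.detAlg (Bandit.policy K d)) Δ a (hist h) *
        Bandit.gain Δ τ a (hist h) := by
    refine le_trans ?_ (Finset.card_nsmul_le_sum A _ _ hgain)
    rw [nsmul_eq_mul]
    exact mul_le_mul_of_nonneg_right (hx12.trans hAcard) (by positivity)
  refine le_trans ?_ (hinfo.trans (Bandit.mutualInfo_le_IStar (by omega)
    (Bandit.isAlg_detAlg _) h0 h1 t))
  refine le_trans ?_ (mul_le_mul_of_nonneg_left hsum (by positivity))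
  have e : 29 * Δ ^ 2 / (8000 * n) * (t * Δ ^ 2 / 12 * (τ / 6)) =
      29 / 2304000 * (ε * t * Δ ^ 2 * Real.log n / n) := by
    rw [hτdef]
    field_simp
    norm_num
  have hpos : 0 ≤ ε * t * Δ ^ 2 * Real.log n / n := by positivity
  rw [e]
  calc ε / 100000 * t * Δ ^ 2 * Real.log n / n =
        1 / 100000 * (ε * t * Δ ^ 2 * Real.log n / n) := by ring
    _ ≤ _ := mul_le_mul_of_nonneg_right (by norm_num) hpos
end
end

section
/- For every ε ∈ (0,1) there exists a constant c > 0 such that for all integers n ≥ 2, all Δ ∈ (0, 1-ε], and all horizons t ∈ ℕ with 1 ≤ t ≤ n/Δ², there exists an interactive algorithm with the following property: writing P_i for the conditional law of the history H_t given a* = i (a probability measure on ([n]×{0,1})^t), one has inf over all probability measures P_0 on ([n]×{0,1})^t of (1/n)·Σ_{i=1}^n TV(P_0, P_i) ≥ c·min(t/n, √(t/n))·Δ, where TV denotes total variation distance. -/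
open scoped BigOperators

noncomputable section

/-- The deterministic algorithm which pulls the arms cyclically. -/
def roundRobin (n : ℕ) [NeZero n] (h : List (Fin n × Bool)) (a : Fin n) : ℝ :=
  if a = Fin.ofNat n h.length then 1 else 0

theorem isAlg_roundRobin (n : ℕ) [NeZero n] : IsAlg n (roundRobin n) := by
  intro h
  refine ⟨fun a => ?_, ?_⟩
  · unfold roundRobin
    split_ifs <;> norm_num
  · simp [roundRobin]

theorem length_hist {n t : ℕ} (h : Fin t → Fin n × Bool) : (hist h).length = t := by
  simp [hist]

/-- Under the round robin algorithm the expectation of a product of functions of the successive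
pulls factorizes. -/
theorem sum_histP_roundRobin_mul_prod (n : ℕ) [NeZero n] (Δ : ℝ) (j : Fin n)
    (w : Fin n × Bool → ℂ) (t : ℕ) :
    ∑ h : Fin t → Fin n × Bool,
        (histP n (roundRobin n) Δ j (hist h) : ℂ) * ((hist h).map w).prod =
      ∏ s ∈ Finset.range t,
        ∑ r : Bool, (rewP n Δ j (Fin.ofNat n s) r : ℂ) * w (Fin.ofNat n s, r) := by
  induction t with
  | zero => simp [hist, histP]
  | succ t ih =>
    rw [Finset.prod_range_succ, ← ih, Finset.sum_mul,
      ← (Fin.snocEquiv (fun _ : Fin (t + 1) => Fin n × Bool)).sum_comp, Fintype.sum_prod_type,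
      Finset.sum_comm]
    refine Finset.sum_congr rfl fun h _ => ?_
    rw [Fintype.sum_prod_type]
    have key : ∀ x : Fin n × Bool,
        (histP n (roundRobin n) Δ j (hist (Fin.snocEquiv (fun _ => Fin n × Bool) (x, h))) : ℂ) *
          ((hist (Fin.snocEquiv (fun _ => Fin n × Bool) (x, h))).map w).prod =
        if x.1 = Fin.ofNat n t then (histP n (roundRobin n) Δ j (hist h) : ℂ) *
          ((hist h).map w).prod * ((rewP n Δ j x.1 x.2 : ℂ) * w x) else 0 := by
      rintro ⟨a, r⟩
      have : Fin.snocEquiv (fun _ : Fin (t + 1) => Fin n × Bool) ((a, r), h) =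
        (Fin.snoc h (a, r) : Fin (t + 1) → Fin n × Bool) := rfl
      rw [this, hist_snoc]
      simp only [histP, roundRobin, length_hist, List.map_cons, List.prod_cons]
      split_ifs <;> push_cast <;> ring
    simp only [key]
    rw [Finset.sum_eq_single (Fin.ofNat n t)]
    · simp only [if_true, Finset.mul_sum]
    · intro b _ hb
      simp only [if_neg hb, Finset.sum_const_zero]
    · simp

theorem card_filter_ofNat_eq_le (n : ℕ) [NeZero n] (t : ℕ) (i : Fin n) :
    ((Finset.range t).filter fun s => Fin.ofNat n s = i).card ≤ t / n + 1 := by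
  rw [← Finset.card_range (t / n + 1)]
  refine Finset.card_le_card_of_injOn (fun s => s / n) ?_ ?_
  · intro s hs
    simp only [Finset.coe_filter, Finset.mem_range, Set.mem_ofPred_eq] at hs
    simpa [Nat.lt_succ_iff] using Nat.div_le_div_right hs.1.le
  · intro s hs s' hs' h
    simp only [Finset.coe_filter, Finset.mem_range, Set.mem_ofPred_eq] at hs hs'
    have h1 : s % n = s' % n := by
      simpa [Fin.ofNat] using congrArg Fin.val (hs.2.trans hs'.2.symm)
    rw [← Nat.div_add_mod s n, ← Nat.div_add_mod s' n, h1]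
    simp only at h
    rw [h]

theorem sum_card_filter_ofNat_eq (n : ℕ) [NeZero n] (t : ℕ) :
    ∑ i : Fin n, ((Finset.range t).filter fun s => Fin.ofNat n s = i).card = t := by
  rw [← Finset.card_eq_sum_card_fiberwise (fun _ _ => Finset.mem_coe.2 (Finset.mem_univ _)),
    Finset.card_range]

/-- The first powers of a complex number close to `1` have imaginary part of linear growth. -/
theorem re_im_pow_bounds {C y δ : ℝ} {K : ℕ} (hy : 0 ≤ y) (hC1 : C ≤ 1)
    (hδ : 0 ≤ δ) (hC : 1 - δ ≤ C) (hKδ : K * δ ≤ 1 / 8) (hKy : (K : ℝ) ^ 2 * y ^ 2 ≤ 1 / 2)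
    (k : ℕ) (hk : k ≤ K) :
    1 - k * δ - k ^ 2 * y ^ 2 ≤ ((⟨C, y⟩ : ℂ) ^ k).re ∧ ((⟨C, y⟩ : ℂ) ^ k).re ≤ 1 ∧
      k * y / 4 ≤ ((⟨C, y⟩ : ℂ) ^ k).im ∧ ((⟨C, y⟩ : ℂ) ^ k).im ≤ k * y := by
  induction k with
  | zero => simp
  | succ k ih =>
    obtain ⟨h1, h2, h3, h4⟩ := ih (by omega)
    rw [pow_succ (⟨C, y⟩ : ℂ), Complex.mul_re, Complex.mul_im]
    set a := ((⟨C, y⟩ : ℂ) ^ k).re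
    set b := ((⟨C, y⟩ : ℂ) ^ k).im
    have hkK : (k : ℝ) ≤ K := by exact_mod_cast (by omega : k ≤ K)
    have hk0 : (0 : ℝ) ≤ k := k.cast_nonneg
    have hkδ : (k : ℝ) * δ ≤ 1 / 8 := (mul_le_mul_of_nonneg_right hkK hδ).trans hKδ
    have hky : (k : ℝ) ^ 2 * y ^ 2 ≤ 1 / 2 := le_trans (by gcongr) hKy
    have ha : 3 / 8 ≤ a := by linarith
    have hb : 0 ≤ b := le_trans (by positivity) h3
    have hya : y * (3 / 8) ≤ y * a := by gcongr
    have hya1 : y * a ≤ y := mul_le_of_le_one_right hy h2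
    have hyb : b * y ≤ k * y * y := by gcongr
    have hCa : (1 - δ) * a ≤ C * a := by gcongr
    have hCa1 : C * a ≤ 1 := mul_le_one₀ hC1 (by linarith) h2
    have hδa : δ * a ≤ δ := mul_le_of_le_one_right hδ h2
    have hCb : (1 - δ) * b ≤ C * b := by gcongr
    have hCb1 : C * b ≤ b := mul_le_of_le_one_left hb hC1
    have hδb : δ * b ≤ δ * (k * y) := by gcongr
    have hkδy : k * δ * y ≤ 1 / 8 * y := by gcongr
    have hyb0 : 0 ≤ b * y := by positivity
    push_cast
    refine ⟨?_, ?_, ?_, ?_⟩ <;> nlinarith [sq_nonneg y, mul_nonneg hk0 (sq_nonneg y)]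

/-- The Fourier character in direction `i` of a single pull. -/
def pullChar {n : ℕ} (lam : ℝ) (i : Fin n) (x : Fin n × Bool) : ℂ :=
  if x.1 = i then ⟨Real.cos lam, if x.2 then Real.sin lam else -Real.sin lam⟩ else 1

theorem norm_prod_pullChar {n : ℕ} (lam : ℝ) (i : Fin n) (l : List (Fin n × Bool)) :
    ‖(l.map (pullChar lam i)).prod‖ = 1 := by
  have h (x : Fin n × Bool) : ‖pullChar lam i x‖ = 1 := by
    unfold pullChar
    split_ifs <;> simp [Complex.norm_def, Complex.normSq_mk, ← sq]
  induction l with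
  | nil => simp
  | cons x l ih => simp [h, ih]

theorem sum_rewP_mul_pullChar {n : ℕ} (Δ lam : ℝ) (i j a : Fin n) :
    ∑ r : Bool, (rewP n Δ j a r : ℂ) * pullChar lam i (a, r) =
      if a = i then ⟨Real.cos lam, (if j = i then Δ else -Δ) * Real.sin lam⟩ else 1 := by
  rcases eq_or_ne a i with rfl | hai
  · apply Complex.ext <;>
      by_cases hj : j = a <;> simp [rewP, pullChar, hj, eq_comm (a := a) (b := j)] <;> ring
  · simp [rewP, pullChar, hai]

/-- Total variation between the laws of the round robin history under two best arms. -/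
theorem le_sum_abs_histP_sub (n : ℕ) [NeZero n] (Δ lam : ℝ) (t : ℕ) {i j : Fin n} (hij : j ≠ i) :
    2 * ((⟨Real.cos lam, Δ * Real.sin lam⟩ : ℂ) ^
        ((Finset.range t).filter fun s => Fin.ofNat n s = i).card).im ≤
      ∑ h : Fin t → Fin n × Bool,
        |histP n (roundRobin n) Δ i (hist h) - histP n (roundRobin n) Δ j (hist h)| := by
  set N := ((Finset.range t).filter fun s => Fin.ofNat n s = i).card
  have E (k : Fin n) := sum_histP_roundRobin_mul_prod n Δ k (pullChar lam i) t
  simp only [sum_rewP_mul_pullChar, Finset.prod_ite, Finset.prod_const, one_pow, mul_one] at E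
  have hi := E i
  have hj := E j
  rw [if_pos rfl] at hi
  rw [if_neg hij] at hj
  have hconj : (⟨Real.cos lam, -Δ * Real.sin lam⟩ : ℂ) =
      (starRingEnd ℂ) ⟨Real.cos lam, Δ * Real.sin lam⟩ := by
    apply Complex.ext <;> simp
  rw [hconj, ← map_pow] at hj
  calc _ = ((⟨Real.cos lam, Δ * Real.sin lam⟩ : ℂ) ^ N -
        (starRingEnd ℂ) ((⟨Real.cos lam, Δ * Real.sin lam⟩ : ℂ) ^ N)).im := by
        rw [Complex.sub_im, Complex.conj_im]; ring
    _ ≤ ‖(⟨Real.cos lam, Δ * Real.sin lam⟩ : ℂ) ^ N -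
        (starRingEnd ℂ) ((⟨Real.cos lam, Δ * Real.sin lam⟩ : ℂ) ^ N)‖ :=
        (le_abs_self _).trans (Complex.abs_im_le_norm _)
    _ ≤ _ := by
        rw [← hj, ← hi, ← Finset.sum_sub_distrib]
        refine (norm_sum_le _ _).trans (Finset.sum_le_sum fun h _ => le_of_eq ?_)
        rw [← sub_mul, norm_mul, norm_prod_pullChar, mul_one, ← Complex.ofReal_sub,
          Complex.norm_real, Real.norm_eq_abs]

/-- A version of Le Cam's two-point bound, averaged along a permutation. -/
theorem sum_sum_abs_sub_le {ι Ω : Type*} [Fintype ι] [Fintype Ω] (σ : Equiv.Perm ι)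
    (P : ι → Ω → ℝ) (q : Ω → ℝ) :
    ∑ i, ∑ h, |P i h - P (σ i) h| ≤ 2 * ∑ i, ∑ h, |q h - P i h| := by
  have h := Equiv.sum_comp σ fun i => ∑ h, |q h - P i h|
  rw [two_mul]
  nth_rewrite 2 [← h]
  rw [← Finset.sum_add_distrib]
  refine Finset.sum_le_sum fun i _ => ?_
  rw [← Finset.sum_add_distrib]
  refine Finset.sum_le_sum fun h _ => ?_
  rw [abs_sub_comm (q h) (P i h)]
  exact abs_sub_le _ _ _

theorem min_self_sqrt_le {x : ℝ} (hx : 0 ≤ x) :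
    min x √x ≤ 2 * (x * (√(x + 1))⁻¹) := by
  have hpos : 0 < √(x + 1) := Real.sqrt_pos.2 (by linarith)
  rw [← div_eq_mul_inv, ← mul_div_assoc, le_div_iff₀ hpos]
  rcases le_total x 1 with h | h
  · have : √(x + 1) ≤ 2 := Real.sqrt_le_iff.2 ⟨by norm_num, by linarith⟩
    calc min x √x * √(x + 1) ≤ x * 2 := by gcongr; exact min_le_left _ _
      _ = _ := mul_comm _ _
  · have h2 : √(x + 1) ≤ 2 * √x := Real.sqrt_le_iff.2
      ⟨by positivity, by rw [mul_pow, Real.sq_sqrt hx]; linarith⟩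
    calc min x √x * √(x + 1) ≤ √x * (2 * √x) := by gcongr; exact min_le_right _ _
      _ = 2 * (√x * √x) := by ring
      _ = _ := by rw [Real.mul_self_sqrt hx]

/-- Failure of the two-point method: for every `ε ∈ (0,1)` there is `c > 0` such that for all
`n ≥ 2`, `Δ ∈ (0, 1-ε]` and horizons `1 ≤ t ≤ n/Δ²`, there is an interactive algorithm such
that, writing `P_i` for the conditional law of the history `H_t` given `a* = i`, every
probability measure `P_0` on histories satisfies
`(1/n) ∑_i TV(P_0, P_i) ≥ c · min(t/n, √(t/n)) · Δ`. -/
theorem bandit_two_point_failure :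
    ∀ ε : ℝ, ε ∈ Set.Ioo (0 : ℝ) 1 → ∃ c : ℝ, 0 < c ∧
      ∀ n : ℕ, 2 ≤ n → ∀ Δ : ℝ, Δ ∈ Set.Ioc (0 : ℝ) (1 - ε) →
        ∀ t : ℕ, 1 ≤ t → (t : ℝ) ≤ (n : ℝ) / Δ ^ 2 →
          ∃ alg, IsAlg n alg ∧
            ∀ q : (Fin t → Fin n × Bool) → ℝ,
              (∀ h, 0 ≤ q h) → (∑ h : Fin t → Fin n × Bool, q h) = 1 →
                c * min ((t : ℝ) / n) (Real.sqrt ((t : ℝ) / n)) * Δ ≤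
                  ((n : ℝ))⁻¹ * ∑ i : Fin n,
                    (1 / 2) * ∑ h : Fin t → Fin n × Bool,
                      |q h - histP n alg Δ i (hist h)| := by
  rintro ε ⟨hε, -⟩
  refine ⟨1 / 64, by norm_num, ?_⟩
  rintro n hn Δ ⟨hΔ, hΔε⟩ t - ht
  have : NeZero n := ⟨by omega⟩
  have : Nontrivial (Fin n) := Fin.nontrivial_iff_two_le.2 hn
  refine ⟨roundRobin n, isAlg_roundRobin n, fun q _ _ => ?_⟩
  have hn0 : (0 : ℝ) < n := by exact_mod_cast (by omega : 0 < n)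
  set x : ℝ := t / n with hx
  have hx0 : 0 ≤ x := by positivity
  have hxΔ : x * Δ ^ 2 ≤ 1 := by
    rw [le_div_iff₀ (by positivity)] at ht
    rw [hx, div_mul_eq_mul_div, div_le_one hn0]
    exact ht
  have hΔ2 : Δ ^ 2 ≤ 1 := pow_le_one₀ hΔ.le (by linarith)
  set lam : ℝ := (√(x + 1))⁻¹ / 2 with hlam
  have hlam0 : 0 < lam := by positivity
  have hlam2 : (x + 1) * lam ^ 2 = 1 / 4 := by
    rw [hlam, div_pow, inv_pow, Real.sq_sqrt (by positivity)]
    field_simp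
    norm_num
  have hlamhalf : lam ≤ 1 / 2 := by nlinarith [mul_nonneg hx0 (sq_nonneg lam)]
  have hsin : lam / 2 ≤ Real.sin lam := by
    have := Real.sin_gt_sub_cube hlam0
    nlinarith [mul_nonneg hlam0.le (sub_nonneg.2 hlamhalf), pow_pos hlam0 2]
  have hsin0 : 0 ≤ Real.sin lam := by linarith
  have hsinle : Real.sin lam ≤ lam := Real.sin_le hlam0.le
  have hcos : 1 - lam ^ 2 / 2 ≤ Real.cos lam := Real.one_sub_sq_div_two_le_cos
  set N : Fin n → ℕ := fun i => ((Finset.range t).filter fun s => Fin.ofNat n s = i).card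
  have hNle (i : Fin n) : (N i : ℝ) ≤ x + 1 := by
    have h : (N i : ℝ) ≤ (t / n : ℕ) + 1 := by exact_mod_cast card_filter_ofNat_eq_le n t i
    linarith [Nat.cast_div_le (α := ℝ) (m := t) (n := n)]
  have hNsum : ∑ i, (N i : ℝ) = t := by exact_mod_cast sum_card_filter_ofNat_eq n t
  have hTV (i : Fin n) : N i * (Δ * Real.sin lam) / 2 ≤ ∑ h : Fin t → Fin n × Bool,
      |histP n (roundRobin n) Δ i (hist h) -
        histP n (roundRobin n) Δ (Equiv.addRight 1 i) (hist h)| := by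
    have h := le_sum_abs_histP_sub n Δ lam t (i := i) (j := Equiv.addRight 1 i)
      (by simp [show n ≠ 1 by omega])
    have h' := (re_im_pow_bounds (C := Real.cos lam) (y := Δ * Real.sin lam) (δ := lam ^ 2 / 2)
      (K := N i) (by positivity) (Real.cos_le_one _) (by positivity) hcos
      (by nlinarith [mul_le_mul_of_nonneg_right (hNle i) (sq_nonneg lam)]) ?_ _ le_rfl).2.2.1
    · linarith
    · calc (N i : ℝ) ^ 2 * (Δ * Real.sin lam) ^ 2 ≤ (x + 1) ^ 2 * (Δ * lam) ^ 2 := by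
            gcongr
            exact hNle i
        _ = (x * Δ ^ 2 + Δ ^ 2) * ((x + 1) * lam ^ 2) := by ring
        _ ≤ 1 / 2 := by rw [hlam2]; linarith
  have hsum : t * (Δ * Real.sin lam) / 2 ≤ 2 * ∑ i : Fin n, ∑ h : Fin t → Fin n × Bool,
      |q h - histP n (roundRobin n) Δ i (hist h)| := by
    rw [← hNsum, Finset.sum_mul, Finset.sum_div]
    exact (Finset.sum_le_sum fun i _ => hTV i).trans
      (sum_sum_abs_sub_le (Equiv.addRight 1) (fun i h => histP n (roundRobin n) Δ i (hist h)) q)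
  rw [← Finset.mul_sum]
  calc 1 / 64 * min x √x * Δ ≤ 1 / 64 * (2 * (x * (√(x + 1))⁻¹)) * Δ := by
        gcongr
        exact min_self_sqrt_le hx0
    _ = x * Δ * (lam / 2) / 4 * (1 / 2) := by rw [hlam]; ring
    _ ≤ x * Δ * Real.sin lam / 4 * (1 / 2) := by gcongr
    _ = (n : ℝ)⁻¹ * (1 / 2 * (t * (Δ * Real.sin lam) / 2 / 2)) := by rw [hx]; ring
    _ ≤ _ := by gcongr; linarith
end
end
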